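/- arXiv:2308.00372 — 5 statements merged into one kernel-verified Lean document; each statement's English description precedes it below -/
import Mathlib

section
/- (Well-posedness of the micro-macro decomposition.) Assume ω ∈ ℝ^r satisfies the Diophantine condition with constants c_D > 0 and ν > 0. Let μ > 0, M > 0, c ∈ (0,1), and let a : [0,∞) → End(X) be sharp-flat of class μ with 𝒩_μ(a) ≤ M. Then for every n ∈ ℕ there exists ε_n > 0 (depending only on n, c, μ, M, c_D, ν, r) such that for every ε ∈ (0, ε_n] there exist a C¹ map Φ : [0,∞) → End(X) and an operator A ∈ End(X) with: (i) ⟨Φ⟩ = id and A = ⟨aΦ⟩; (ii) sup_{τ≥0} |Φ_τ − id| ≤ cε/ε_n ≤ c; (iii) |A| ≤ (1+c)M; and (iv) the defect δ_τ := ε^{-1}∂_τΦ_τ − (a_τΦ_τ − Φ_τA) has zero time average and satisfies sup_{τ≥0} |δ_τ| ≤ M(ε/ε_n)^n as well as sup_{τ≥0} |ε ∫_0^τ δ_σ dσ| ≤ (ε/ε_n)^{n+1}. -/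
open scoped BigOperators
open Filter MeasureTheory

noncomputable section

variable {X : Type*} [NormedAddCommGroup X] [NormedSpace ℂ X] [CompleteSpace X]

/-- `|α| = |α₁| + ⋯ + |α_r|` for a multi-index `α ∈ ℤ^r`. -/
def absIdx {r : ℕ} (α : Fin r → ℤ) : ℝ := ∑ i, |(α i : ℝ)|

/-- `α · ω = α₁ω₁ + ⋯ + α_rω_r`. -/
def dotIdx {r : ℕ} (ω : Fin r → ℝ) (α : Fin r → ℤ) : ℝ := ∑ i, (α i : ℝ) * ω i

/-- The quasi-periodic ("sharp") map generated by a family of Fourier coefficients: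
`τ ↦ Σ_α e^{i(α·ω)τ} φ̂_α`. -/
def sharpSum {r : ℕ} (ω : Fin r → ℝ) (φhat : (Fin r → ℤ) → (X →L[ℂ] X)) (τ : ℝ) :
    X →L[ℂ] X :=
  ∑' α : Fin r → ℤ, Complex.exp (Complex.I * (dotIdx ω α : ℂ) * (τ : ℂ)) • φhat α

/-- The weighted ℓ¹-norm `Σ_α e^{κ|α|} ‖φ̂_α‖` of a family of Fourier coefficients. -/
def sharpNorm {r : ℕ} (κ : ℝ) (φhat : (Fin r → ℤ) → (X →L[ℂ] X)) : ℝ :=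
  ∑' α : Fin r → ℤ, Real.exp (κ * absIdx α) * ‖φhat α‖

/-- `sup_{τ ≥ 0} e^τ ‖φ♭_τ‖` for the exponentially decaying ("flat") part. -/
def flatSup (φflat : ℝ → (X →L[ℂ] X)) : ℝ :=
  ⨆ τ : Set.Ici (0:ℝ), Real.exp (τ : ℝ) * ‖φflat (τ : ℝ)‖

/-- The sharp-flat norm `𝒩_κ(φ) = Σ_α e^{κ|α|}‖φ̂_α‖ + sup_{τ≥0} e^τ‖φ♭_τ‖`. -/
def SFNorm {r : ℕ} (κ : ℝ) (φhat : (Fin r → ℤ) → (X →L[ℂ] X))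
    (φflat : ℝ → (X →L[ℂ] X)) : ℝ :=
  sharpNorm κ φhat + flatSup φflat

/-- `φ : [0,∞) → End(X)` is sharp-flat of class `κ`, with sharp Fourier coefficients
`φhat` and flat part `φflat`. -/
structure IsSharpFlat {r : ℕ} (ω : Fin r → ℝ) (κ : ℝ) (φ : ℝ → (X →L[ℂ] X))
    (φhat : (Fin r → ℤ) → (X →L[ℂ] X)) (φflat : ℝ → (X →L[ℂ] X)) : Prop where
  summable : Summable fun α : Fin r → ℤ => Real.exp (κ * absIdx α) * ‖φhat α‖
  flat_cont : ContinuousOn φflat (Set.Ici 0)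
  flat_bdd : BddAbove (Set.range fun τ : Set.Ici (0:ℝ) => Real.exp (τ : ℝ) * ‖φflat (τ : ℝ)‖)
  decomp : ∀ τ : ℝ, 0 ≤ τ → φ τ = sharpSum ω φhat τ + φflat τ

/-- The time average `⟨φ⟩ = lim_{T→∞} (1/T) ∫₀^T φ_σ dσ` equals `B`. -/
def HasTimeAvg {E : Type*} [NormedAddCommGroup E] [NormedSpace ℝ E] (φ : ℝ → E) (B : E) : Prop :=
  Tendsto (fun T : ℝ => (1 / T) • ∫ σ in (0:ℝ)..T, φ σ) atTop (nhds B)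

/-- The constant `c_I(κ) = max{1, (1/c_D)(ν/(κe))^ν}` from the integration lemma. -/
def cI (c_D ν κ : ℝ) : ℝ := max 1 ((1 / c_D) * (ν / (κ * Real.exp 1)) ^ ν)

set_option linter.unusedSectionVars false

section Aux

variable {E : Type*} [NormedRing E] [NormedAlgebra ℂ E]
  [CompleteSpace E]

/-- the character `e^{i(α·ω)τ}` -/
def ee {r : ℕ} (ω : Fin r → ℝ) (α : Fin r → ℤ) (τ : ℝ) : ℂ :=
  Complex.exp (Complex.I * (dotIdx ω α : ℂ) * (τ : ℂ))

lemma norm_ee {r : ℕ} (ω : Fin r → ℝ) (α : Fin r → ℤ) (τ : ℝ) : ‖ee ω α τ‖ = 1 := by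
  unfold ee
  rw [show Complex.I * (dotIdx ω α : ℂ) * (τ : ℂ) = ((dotIdx ω α * τ : ℝ) : ℂ) * Complex.I by
    push_cast; ring]
  exact Complex.norm_exp_ofReal_mul_I _

lemma dotIdx_add {r : ℕ} (ω : Fin r → ℝ) (α β : Fin r → ℤ) :
    dotIdx ω (α + β) = dotIdx ω α + dotIdx ω β := by
  simp [dotIdx, add_mul, Finset.sum_add_distrib]

lemma dotIdx_zero {r : ℕ} (ω : Fin r → ℝ) : dotIdx ω 0 = 0 := by
  simp [dotIdx]

lemma absIdx_zero {r : ℕ} : absIdx (0 : Fin r → ℤ) = 0 := by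
  simp [absIdx]

lemma absIdx_nonneg {r : ℕ} (α : Fin r → ℤ) : 0 ≤ absIdx α :=
  Finset.sum_nonneg fun _ _ => abs_nonneg _

lemma absIdx_add_le {r : ℕ} (α β : Fin r → ℤ) : absIdx (α + β) ≤ absIdx α + absIdx β := by
  unfold absIdx
  rw [← Finset.sum_add_distrib]
  refine Finset.sum_le_sum fun i _ => ?_
  simpa using abs_add_le (α i : ℝ) (β i : ℝ)

lemma absIdx_pos {r : ℕ} (α : Fin r → ℤ) (h : α ≠ 0) : 0 < absIdx α := by
  obtain ⟨i, hi⟩ := Function.ne_iff.1 h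
  refine Finset.sum_pos' (fun _ _ => abs_nonneg _) ⟨i, Finset.mem_univ _, ?_⟩
  simpa using hi

lemma ee_add {r : ℕ} (ω : Fin r → ℝ) (α β : Fin r → ℤ) (τ : ℝ) :
    ee ω (α + β) τ = ee ω α τ * ee ω β τ := by
  unfold ee
  rw [dotIdx_add, ← Complex.exp_add]
  congr 1
  push_cast; ring

lemma ee_zero {r : ℕ} (ω : Fin r → ℝ) (τ : ℝ) : ee ω 0 τ = 1 := by
  simp [ee, dotIdx_zero]

lemma hasDerivAt_ee {r : ℕ} (ω : Fin r → ℝ) (α : Fin r → ℤ) (τ : ℝ) :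
    HasDerivAt (ee ω α) (Complex.I * (dotIdx ω α : ℂ) * ee ω α τ) τ := by
  unfold ee
  have h1 : HasDerivAt (fun t : ℝ => Complex.I * (dotIdx ω α : ℂ) * (t : ℂ))
      (Complex.I * (dotIdx ω α : ℂ) * 1) τ :=
    (Complex.ofRealCLM.hasDerivAt (x := τ)).const_mul _
  have := h1.cexp
  convert this using 1
  ring

lemma continuous_ee {r : ℕ} (ω : Fin r → ℝ) (α : Fin r → ℤ) : Continuous (ee ω α) := by
  unfold ee; fun_prop

/-- data of a sharp-flat map, with repeated frequencies allowed -/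
structure IsD {r : ℕ} (ω : Fin r → ℝ) {ι : Type} (κ S F : ℝ) (φ : ℝ → E)
    (α : ι → Fin r → ℤ) (b : ι → E) (f : ℝ → E) : Prop where
  sum : Summable fun i => Real.exp (κ * absIdx (α i)) * ‖b i‖
  le : ∑' i, Real.exp (κ * absIdx (α i)) * ‖b i‖ ≤ S
  cont : Continuous f
  bd : ∀ τ : ℝ, 0 ≤ τ → ‖f τ‖ ≤ F * Real.exp (-τ)
  eq : ∀ τ : ℝ, φ τ = ∑' i, ee ω (α i) τ • b i + f τ

/-- sharp-flat with norm at most `C` -/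
def SF {r : ℕ} (ω : Fin r → ℝ) (κ C : ℝ) (φ : ℝ → E) : Prop :=
  ∃ (ι : Type) (α : ι → Fin r → ℤ) (b : ι → E) (f : ℝ → E) (S F : ℝ),
    IsD ω κ S F φ α b f ∧ S + F ≤ C

section IsD
variable {r : ℕ} {ω : Fin r → ℝ} {ι ι' : Type} {κ S F S' F' : ℝ} {φ ψ : ℝ → E}
    {α : ι → Fin r → ℤ} {b : ι → E} {f : ℝ → E}
    {α' : ι' → Fin r → ℤ} {b' : ι' → E} {f' : ℝ → E}

lemma IsD.norm_le (hκ : 0 ≤ κ) (i : ι) (α : ι → Fin r → ℤ) (b : ι → E) :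
    ‖b i‖ ≤ Real.exp (κ * absIdx (α i)) * ‖b i‖ :=
  le_mul_of_one_le_left (norm_nonneg _)
    (Real.one_le_exp (mul_nonneg hκ (absIdx_nonneg _)))

lemma IsD.sumb (h : IsD ω κ S F φ α b f) (hκ : 0 ≤ κ) : Summable fun i => ‖b i‖ :=
  Summable.of_nonneg_of_le (fun _ => norm_nonneg _) (fun i => IsD.norm_le hκ i α b) h.sum

lemma IsD.sumn (h : IsD ω κ S F φ α b f) (hκ : 0 ≤ κ) (τ : ℝ) :
    Summable fun i => ‖ee ω (α i) τ • b i‖ := by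
  simpa [norm_smul, norm_ee] using h.sumb hκ

lemma IsD.sume (h : IsD ω κ S F φ α b f) (hκ : 0 ≤ κ) (τ : ℝ) :
    Summable fun i => ee ω (α i) τ • b i := (h.sumn hκ τ).of_norm

lemma IsD.S_nonneg (h : IsD ω κ S F φ α b f) : 0 ≤ S :=
  (tsum_nonneg fun _ => by positivity).trans h.le

lemma IsD.F_nonneg (h : IsD ω κ S F φ α b f) : 0 ≤ F := by
  have := (norm_nonneg _).trans (h.bd 0 le_rfl)
  simpa using this

lemma IsD.sumb_le (h : IsD ω κ S F φ α b f) (hκ : 0 ≤ κ) : ∑' i, ‖b i‖ ≤ S :=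
  ((h.sumb hκ).tsum_le_tsum (fun i => IsD.norm_le hκ i α b) h.sum).trans h.le

lemma IsD.sharp_le (h : IsD ω κ S F φ α b f) (hκ : 0 ≤ κ) (τ : ℝ) :
    ‖∑' i, ee ω (α i) τ • b i‖ ≤ S := by
  refine (norm_tsum_le_tsum_norm (h.sumn hκ τ)).trans ?_
  simpa [norm_smul, norm_ee] using h.sumb_le hκ

lemma IsD.sharp_cont (h : IsD ω κ S F φ α b f) (hκ : 0 ≤ κ) :
    Continuous fun τ => ∑' i, ee ω (α i) τ • b i := by
  refine continuous_tsum (fun i => (continuous_ee ω (α i)).smul continuous_const) (h.sumb hκ) ?_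
  intro i τ
  simp [norm_smul, norm_ee]

lemma IsD.φ_cont (h : IsD ω κ S F φ α b f) (hκ : 0 ≤ κ) : Continuous φ := by
  have : φ = fun τ => ∑' i, ee ω (α i) τ • b i + f τ := funext h.eq
  rw [this]
  exact (h.sharp_cont hκ).add h.cont

lemma IsD.φ_le (h : IsD ω κ S F φ α b f) (hκ : 0 ≤ κ) (τ : ℝ) (hτ : 0 ≤ τ) :
    ‖φ τ‖ ≤ S + F := by
  rw [h.eq]
  refine (norm_add_le _ _).trans (add_le_add (h.sharp_le hκ τ) ((h.bd τ hτ).trans ?_))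
  exact mul_le_of_le_one_right h.F_nonneg (Real.exp_le_one_iff.2 (by linarith))

lemma IsD.mul (h : IsD ω κ S F φ α b f) (h' : IsD ω κ S' F' ψ α' b' f') (hκ : 0 ≤ κ) :
    IsD ω κ (S * S') (S * F' + F * S' + F * F') (fun τ => φ τ * ψ τ)
      (fun p : ι × ι' => α p.1 + α' p.2) (fun p => b p.1 * b' p.2)
      (fun τ => (∑' i, ee ω (α i) τ • b i) * f' τ + f τ * (∑' i, ee ω (α' i) τ • b' i)
        + f τ * f' τ) := by
  have hs := h.sum.mul_of_nonneg h'.sum (fun _ => by positivity) (fun _ => by positivity)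
  have hle : ∀ p : ι × ι', Real.exp (κ * absIdx (α p.1 + α' p.2)) * ‖b p.1 * b' p.2‖ ≤
      (Real.exp (κ * absIdx (α p.1)) * ‖b p.1‖) * (Real.exp (κ * absIdx (α' p.2)) * ‖b' p.2‖) := by
    intro p
    have h1 : Real.exp (κ * absIdx (α p.1 + α' p.2)) ≤
        Real.exp (κ * absIdx (α p.1)) * Real.exp (κ * absIdx (α' p.2)) := by
      rw [← Real.exp_add, ← mul_add]
      exact Real.exp_le_exp.2 (mul_le_mul_of_nonneg_left (absIdx_add_le _ _) hκ)
    calc _ ≤ (Real.exp (κ * absIdx (α p.1)) * Real.exp (κ * absIdx (α' p.2))) *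
          (‖b p.1‖ * ‖b' p.2‖) := mul_le_mul h1 (norm_mul_le _ _) (norm_nonneg _) (by positivity)
      _ = _ := by ring
  have hs' := Summable.of_nonneg_of_le (fun p : ι × ι' => by positivity) hle hs
  refine ⟨hs', ?_, ?_, ?_, ?_⟩
  · refine (hs'.tsum_le_tsum hle hs).trans ?_
    rw [← h.sum.tsum_mul_tsum h'.sum hs]
    exact mul_le_mul h.le h'.le (tsum_nonneg fun _ => by positivity) h.S_nonneg
  · have := h.sharp_cont hκ
    have := h'.sharp_cont hκ
    have := h.cont
    have := h'.cont
    fun_prop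
  · intro τ hτ
    have e1 := h.sharp_le hκ τ
    have e2 := h'.sharp_le hκ τ
    have e3 := h.bd τ hτ
    have e4 := h'.bd τ hτ
    have hF := h.F_nonneg
    have hF' := h'.F_nonneg
    have hS := h.S_nonneg
    have e5 : Real.exp (-τ) ≤ 1 := Real.exp_le_one_iff.2 (by linarith)
    have k1 : ‖(∑' i, ee ω (α i) τ • b i) * f' τ‖ ≤ S * (F' * Real.exp (-τ)) :=
      (norm_mul_le _ _).trans (mul_le_mul e1 e4 (norm_nonneg _) hS)
    have k2 : ‖f τ * (∑' i, ee ω (α' i) τ • b' i)‖ ≤ (F * Real.exp (-τ)) * S' :=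
      (norm_mul_le _ _).trans (mul_le_mul e3 e2 (norm_nonneg _) (by positivity))
    have k3 : ‖f τ * f' τ‖ ≤ F * (F' * Real.exp (-τ)) :=
      (norm_mul_le _ _).trans (mul_le_mul (e3.trans (mul_le_of_le_one_right hF e5)) e4
        (norm_nonneg _) hF)
    refine (norm_add₃_le).trans ?_
    linarith
  · intro τ
    rw [h.eq, h'.eq, add_mul, mul_add, mul_add,
      tsum_mul_tsum_of_summable_norm (h.sumn hκ τ) (h'.sumn hκ τ)]
    have : ∀ p : ι × ι', ee ω (α p.1 + α' p.2) τ • (b p.1 * b' p.2) =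
        (ee ω (α p.1) τ • b p.1) * (ee ω (α' p.2) τ • b' p.2) := by
      intro p
      rw [ee_add, smul_mul_smul_comm]
    simp only [this]
    abel

lemma IsD.add (h : IsD ω κ S F φ α b f) (h' : IsD ω κ S' F' ψ α' b' f') (hκ : 0 ≤ κ) :
    IsD ω κ (S + S') (F + F') (fun τ => φ τ + ψ τ)
      (Sum.elim α α') (Sum.elim b b') (fun τ => f τ + f' τ) := by
  refine ⟨Summable.sum _ h.sum h'.sum, ?_, h.cont.add h'.cont, ?_, ?_⟩
  · rw [Summable.tsum_sum (f := fun i => Real.exp (κ * absIdx (Sum.elim α α' i)) *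
      ‖Sum.elim b b' i‖) h.sum h'.sum]
    exact add_le_add h.le h'.le
  · intro τ hτ
    have := norm_add_le (f τ) (f' τ)
    have := h.bd τ hτ
    have := h'.bd τ hτ
    linarith
  · intro τ
    rw [Summable.tsum_sum (f := fun i => ee ω (Sum.elim α α' i) τ • Sum.elim b b' i)
      (h.sume hκ τ) (h'.sume hκ τ), h.eq, h'.eq]
    simp only [Sum.elim_inl, Sum.elim_inr]
    abel

lemma IsD.smul (h : IsD ω κ S F φ α b f) (c : ℂ) (hκ : 0 ≤ κ) :
    IsD ω κ (‖c‖ * S) (‖c‖ * F) (fun τ => c • φ τ) α (fun i => c • b i) (fun τ => c • f τ) := by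
  have e : (fun i => Real.exp (κ * absIdx (α i)) * ‖c • b i‖) =
      fun i => ‖c‖ * (Real.exp (κ * absIdx (α i)) * ‖b i‖) := by
    funext i; rw [norm_smul]; ring
  refine ⟨?_, ?_, h.cont.const_smul c, ?_, ?_⟩
  · rw [e]; exact h.sum.mul_left _
  · rw [e, tsum_mul_left]; exact mul_le_mul_of_nonneg_left h.le (norm_nonneg _)
  · intro τ hτ
    rw [norm_smul, mul_assoc]
    exact mul_le_mul_of_nonneg_left (h.bd τ hτ) (norm_nonneg _)
  · intro τ
    rw [h.eq, smul_add, ← (h.sume hκ τ).tsum_const_smul]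
    congr 2
    funext i
    rw [smul_comm]

lemma IsD.mono {κ' : ℝ} (h : IsD ω κ S F φ α b f) (hκ : κ' ≤ κ) :
    IsD ω κ' S F φ α b f := by
  have hle : ∀ i, Real.exp (κ' * absIdx (α i)) * ‖b i‖ ≤ Real.exp (κ * absIdx (α i)) * ‖b i‖ := by
    intro i
    have := absIdx_nonneg (α i)
    gcongr
  have hs := Summable.of_nonneg_of_le (fun i => by positivity) hle h.sum
  exact ⟨hs, (hs.tsum_le_tsum hle h.sum).trans h.le, h.cont, h.bd, h.eq⟩

lemma IsD.const (κ : ℝ) (B : E) : IsD ω κ ‖B‖ 0 (fun _ => B)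
    (fun _ : Unit => 0) (fun _ => B) (fun _ => 0) := by
  refine ⟨(hasSum_fintype _).summable, ?_, continuous_const, ?_, ?_⟩
  · simp [absIdx_zero]
  · simp
  · simp [ee_zero]

/-- coefficients of the zero-mean antiderivative -/
def intCoef (ω : Fin r → ℝ) (α : ι → Fin r → ℤ) (b : ι → E) (i : ι) : E :=
  if α i = 0 then 0 else (Complex.I * (dotIdx ω (α i) : ℂ))⁻¹ • b i

/-- the mean -/
def meanD (α : ι → Fin r → ℤ) (b : ι → E) : E := ∑' i, if α i = 0 then b i else 0

/-- the zero-mean antiderivative -/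
def intD (ω : Fin r → ℝ) (α : ι → Fin r → ℤ) (b : ι → E) (f : ℝ → E) (τ : ℝ) : E :=
  ∑' i, ee ω (α i) τ • intCoef ω α b i + -∫ σ in Set.Ioi τ, f σ

/-- small divisor bound -/
def SDB (ω : Fin r → ℝ) (κ κ' K : ℝ) : Prop :=
  1 ≤ K ∧ ∀ β : Fin r → ℤ, β ≠ 0 → dotIdx ω β ≠ 0 ∧
    Real.exp (κ' * absIdx β) * |dotIdx ω β|⁻¹ ≤ K * Real.exp (κ * absIdx β)

lemma IsD.flat_int (h : IsD ω κ S F φ α b f) (τ : ℝ) (hτ : 0 ≤ τ) :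
    IntegrableOn f (Set.Ioi τ) := by
  refine Integrable.mono' ((integrableOn_exp_neg_Ioi τ).const_mul F)
    h.cont.aestronglyMeasurable ?_
  refine (ae_restrict_iff' measurableSet_Ioi).2 (Eventually.of_forall fun σ hσ => ?_)
  exact h.bd σ (hτ.trans (le_of_lt hσ))

lemma IsD.flat_int' (h : IsD ω κ S F φ α b f) (τ : ℝ) :
    IntegrableOn f (Set.Ioi τ) := by
  rcases le_total 0 τ with h0 | h0
  · exact h.flat_int τ h0
  · rw [← Set.Ioc_union_Ioi_eq_Ioi h0]
    refine IntegrableOn.union ?_ (h.flat_int 0 le_rfl)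
    exact (h.cont.integrableOn_Icc).mono_set Set.Ioc_subset_Icc_self

lemma IsD.flat_bd (h : IsD ω κ S F φ α b f) (τ : ℝ) (hτ : 0 ≤ τ) :
    ‖-∫ σ in Set.Ioi τ, f σ‖ ≤ F * Real.exp (-τ) := by
  rw [norm_neg, ← integral_exp_neg_Ioi τ, ← integral_const_mul]
  refine norm_integral_le_of_norm_le ((integrableOn_exp_neg_Ioi τ).const_mul F) ?_
  refine (ae_restrict_iff' measurableSet_Ioi).2 (Eventually.of_forall fun σ hσ => ?_)
  exact h.bd σ (hτ.trans (le_of_lt hσ))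

lemma IsD.flat_deriv (h : IsD ω κ S F φ α b f) (τ : ℝ) :
    HasDerivAt (fun τ => -∫ σ in Set.Ioi τ, f σ) (f τ) τ := by
  have e : (fun τ => -∫ σ in Set.Ioi τ, f σ) =
      fun τ => (∫ σ in (0:ℝ)..τ, f σ) - ∫ σ in Set.Ioi (0:ℝ), f σ := by
    funext t
    rw [← intervalIntegral.integral_interval_add_Ioi (h.flat_int' 0) (h.flat_int' t)]
    abel
  rw [e]
  refine HasDerivAt.sub_const _ ?_
  exact intervalIntegral.integral_hasDerivAt_right (h.cont.intervalIntegrable _ _)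
    (h.cont.stronglyMeasurableAtFilter _ _) h.cont.continuousAt

lemma IsD.int {κ' K : ℝ} (h : IsD ω κ S F φ α b f) (hK : SDB ω κ κ' K) :
    IsD ω κ' (K * S) (K * F) (intD ω α b f) α (intCoef ω α b)
      (fun τ => -∫ σ in Set.Ioi τ, f σ) := by
  have hK0 : 0 ≤ K := zero_le_one.trans hK.1
  have hle : ∀ i, Real.exp (κ' * absIdx (α i)) * ‖intCoef ω α b i‖ ≤
      K * (Real.exp (κ * absIdx (α i)) * ‖b i‖) := by
    intro i
    unfold intCoef
    split_ifs with h0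
    · simp only [norm_zero, mul_zero]; positivity
    · have := (hK.2 (α i) h0).2
      rw [norm_smul, norm_inv, norm_mul, Complex.norm_I, one_mul, Complex.norm_real,
        Real.norm_eq_abs, ← mul_assoc, ← mul_assoc]
      exact mul_le_mul_of_nonneg_right this (norm_nonneg _)
  have hs := Summable.of_nonneg_of_le (fun i => by positivity) hle (h.sum.mul_left K)
  refine ⟨hs, ?_, ?_, ?_, fun τ => rfl⟩
  · refine (hs.tsum_le_tsum hle (h.sum.mul_left K)).trans ?_
    rw [tsum_mul_left]
    exact mul_le_mul_of_nonneg_left h.le hK0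
  · exact continuous_iff_continuousAt.2 fun τ => (h.flat_deriv τ).continuousAt
  · intro τ hτ
    refine (h.flat_bd τ hτ).trans ?_
    exact mul_le_mul_of_nonneg_right (le_mul_of_one_le_left h.F_nonneg hK.1) (Real.exp_pos _).le

lemma IsD.int_deriv {κ' K : ℝ} (h : IsD ω κ S F φ α b f) (hκ : 0 ≤ κ) (hκ' : 0 ≤ κ')
    (hK : SDB ω κ κ' K) (τ : ℝ) :
    HasDerivAt (intD ω α b f) (φ τ - meanD α b) τ := by
  have hi := h.int hK
  have hsm : Summable fun i => (if α i = 0 then b i else 0) := by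
    refine Summable.of_norm_bounded (h.sumb hκ) fun i => ?_
    split_ifs <;> simp
  have h1 : HasDerivAt (fun τ => ∑' i, ee ω (α i) τ • intCoef ω α b i)
      (∑' i, (ee ω (α i) τ • b i - if α i = 0 then b i else 0)) τ := by
    refine hasDerivAt_tsum (g := fun i τ => ee ω (α i) τ • intCoef ω α b i)
      (g' := fun i τ => ee ω (α i) τ • b i - if α i = 0 then b i else 0)
      (y₀ := 0) (h.sumb hκ) ?_ ?_ (hi.sume hκ' 0) τ
    · intro i t
      have := (hasDerivAt_ee ω (α i) t).smul_const (intCoef ω α b i)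
      convert this using 1
      unfold intCoef
      split_ifs with h0
      · simp [h0, ee_zero]
      · have hd : (Complex.I * (dotIdx ω (α i) : ℂ)) ≠ 0 :=
          mul_ne_zero Complex.I_ne_zero (by exact_mod_cast (hK.2 _ h0).1)
        rw [sub_zero, smul_smul]
        congr 1
        rw [mul_right_comm, mul_inv_cancel₀ hd, one_mul]
    · intro i t
      split_ifs with h0
      · simp [h0, ee_zero]
      · simp [norm_smul, norm_ee]
  have := h1.add (h.flat_deriv τ)
  have e : φ τ - meanD α b =
      ∑' i, (ee ω (α i) τ • b i - if α i = 0 then b i else 0) + f τ := by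
    rw [h.eq, (h.sume hκ τ).tsum_sub hsm]
    unfold meanD
    abel
  rw [e]
  exact this

lemma avg_of_antideriv {Ψ φ : ℝ → E} {m : E} {B : ℝ} (hφ : Continuous φ)
    (hd : ∀ τ, HasDerivAt Ψ (φ τ - m) τ) (hB : ∀ τ, 0 ≤ τ → ‖Ψ τ‖ ≤ B) : HasTimeAvg φ m := by
  unfold HasTimeAvg
  have e : ∀ T : ℝ, 0 < T → (1 / T) • ∫ σ in (0:ℝ)..T, φ σ = (1 / T) • (Ψ T - Ψ 0) + m := by
    intro T hT
    have h1 : ∫ σ in (0:ℝ)..T, (φ σ - m) = Ψ T - Ψ 0 :=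
      intervalIntegral.integral_eq_sub_of_hasDerivAt (fun τ _ => hd τ)
        ((hφ.sub continuous_const).intervalIntegrable _ _)
    rw [← h1, intervalIntegral.integral_sub (hφ.intervalIntegrable _ _)
      (continuous_const.intervalIntegrable _ _), intervalIntegral.integral_const, sub_zero,
      smul_sub, smul_smul, one_div_mul_cancel hT.ne', one_smul, sub_add_cancel]
  have h0 : Tendsto (fun T : ℝ => (1 / T) • (Ψ T - Ψ 0)) atTop (nhds 0) := by
    refine squeeze_zero_norm' (a := fun T : ℝ => (1 / T) * (B + B)) ?_ ?_
    · filter_upwards [eventually_gt_atTop 0] with T hT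
      rw [norm_smul, Real.norm_of_nonneg (by positivity)]
      refine mul_le_mul_of_nonneg_left ?_ (by positivity)
      exact (norm_sub_le _ _).trans (add_le_add (hB _ hT.le) (hB _ le_rfl))
    · have := (tendsto_inv_atTop_zero (𝕜 := ℝ)).mul_const (B + B)
      simpa using this
  have := h0.add_const m
  rw [zero_add] at this
  refine this.congr' ?_
  filter_upwards [eventually_gt_atTop 0] with T hT
  exact (e T hT).symm

lemma IsD.avg {κ' K : ℝ} (h : IsD ω κ S F φ α b f) (hκ : 0 ≤ κ) (hκ' : 0 ≤ κ')
    (hK : SDB ω κ κ' K) : HasTimeAvg φ (meanD α b) :=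
  avg_of_antideriv (h.φ_cont hκ) (h.int_deriv hκ hκ' hK) ((h.int hK).φ_le hκ')

lemma IsD.norm_mean (h : IsD ω κ S F φ α b f) (hκ : 0 ≤ κ) : ‖meanD α b‖ ≤ S := by
  unfold meanD
  refine (tsum_of_norm_bounded (h.sumb hκ).hasSum fun i => ?_).trans (h.sumb_le hκ)
  split_ifs <;> simp

lemma mean_intCoef (ω : Fin r → ℝ) (α : ι → Fin r → ℤ) (b : ι → E) :
    meanD α (intCoef ω α b) = 0 := by
  unfold meanD intCoef
  rw [← tsum_zero (α := E) (β := ι)]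
  congr 1
  funext i
  split_ifs <;> simp_all

end IsD

lemma exists_SDB {r : ℕ} (ω : Fin r → ℝ) (c_D ν : ℝ) (hcD : 0 < c_D) (hν : 0 < ν)
    (hdio : ∀ α : Fin r → ℤ, α ≠ 0 → c_D / (absIdx α) ^ ν ≤ |dotIdx ω α|)
    (κ κ' : ℝ) (hκ : κ' < κ) : ∃ K, SDB ω κ κ' K := by
  set η := κ - κ' with hη
  have hη0 : 0 < η := by linarith
  refine ⟨max 1 ((ν / η) ^ ν / c_D), le_max_left _ _, fun β hβ => ?_⟩
  have hx := absIdx_pos β hβ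
  set x := absIdx β
  have hxν : 0 < x ^ ν := Real.rpow_pos_of_pos hx ν
  have hd := hdio β hβ
  have hq : 0 < c_D / x ^ ν := by positivity
  have hdpos : 0 < |dotIdx ω β| := hq.trans_le hd
  refine ⟨abs_pos.1 hdpos, ?_⟩
  have h1 : x ≤ (ν / η) * Real.exp (η * x / ν) := by
    have h2 : η * x / ν ≤ Real.exp (η * x / ν) := by
      have := Real.add_one_le_exp (η * x / ν); linarith
    calc x = (ν / η) * (η * x / ν) := by field_simp
      _ ≤ _ := mul_le_mul_of_nonneg_left h2 (by positivity)
  have h3 : x ^ ν ≤ (ν / η) ^ ν * Real.exp (η * x) := by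
    refine (Real.rpow_le_rpow hx.le h1 hν.le).trans ?_
    rw [Real.mul_rpow (by positivity) (Real.exp_pos _).le, ← Real.exp_mul,
      div_mul_cancel₀ _ hν.ne']
  have h4 : |dotIdx ω β|⁻¹ ≤ (ν / η) ^ ν / c_D * Real.exp (η * x) := by
    calc |dotIdx ω β|⁻¹ ≤ (c_D / x ^ ν)⁻¹ := inv_anti₀ hq hd
      _ = x ^ ν / c_D := inv_div _ _
      _ ≤ ((ν / η) ^ ν * Real.exp (η * x)) / c_D := by gcongr
      _ = _ := by ring
  calc Real.exp (κ' * x) * |dotIdx ω β|⁻¹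
      ≤ Real.exp (κ' * x) * ((ν / η) ^ ν / c_D * Real.exp (η * x)) := by gcongr
    _ = (ν / η) ^ ν / c_D * Real.exp (κ * x) := by
      rw [show κ * x = κ' * x + η * x by rw [hη]; ring, Real.exp_add]; ring
    _ ≤ _ := mul_le_mul_of_nonneg_right (le_max_right _ _) (Real.exp_pos _).le

section SFsec
variable {r : ℕ} {ω : Fin r → ℝ} {κ κ' κ'' C C' K K' : ℝ} {φ ψ : ℝ → E} {m m' : E}

lemma SF.le (h : SF ω κ C φ) (hC : C ≤ C') : SF ω κ C' φ := by
  obtain ⟨ι, α, b, f, S, F, hd, hs⟩ := h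
  exact ⟨ι, α, b, f, S, F, hd, hs.trans hC⟩

lemma SF.nonneg (h : SF ω κ C φ) : 0 ≤ C := by
  obtain ⟨ι, α, b, f, S, F, hd, hs⟩ := h
  linarith [hd.S_nonneg, hd.F_nonneg]

lemma SF.mono (h : SF ω κ C φ) (hκ : κ' ≤ κ) : SF ω κ' C φ := by
  obtain ⟨ι, α, b, f, S, F, hd, hs⟩ := h
  exact ⟨ι, α, b, f, S, F, hd.mono hκ, hs⟩

lemma SF.mul (h : SF ω κ C φ) (h' : SF ω κ C' ψ) (hκ : 0 ≤ κ) :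
    SF ω κ (C * C') (fun τ => φ τ * ψ τ) := by
  have hC := h.nonneg
  obtain ⟨ι, α, b, f, S, F, hd, hs⟩ := h
  obtain ⟨ι', α', b', f', S', F', hd', hs'⟩ := h'
  refine ⟨_, _, _, _, _, _, hd.mul hd' hκ, ?_⟩
  calc S * S' + (S * F' + F * S' + F * F') = (S + F) * (S' + F') := by ring
    _ ≤ C * C' := mul_le_mul hs hs' (add_nonneg hd'.S_nonneg hd'.F_nonneg) hC

lemma SF.add (h : SF ω κ C φ) (h' : SF ω κ C' ψ) (hκ : 0 ≤ κ) :
    SF ω κ (C + C') (fun τ => φ τ + ψ τ) := by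
  obtain ⟨ι, α, b, f, S, F, hd, hs⟩ := h
  obtain ⟨ι', α', b', f', S', F', hd', hs'⟩ := h'
  exact ⟨_, _, _, _, _, _, hd.add hd' hκ, by linarith⟩

lemma SF.smul (h : SF ω κ C φ) (c : ℂ) (hκ : 0 ≤ κ) :
    SF ω κ (‖c‖ * C) (fun τ => c • φ τ) := by
  obtain ⟨ι, α, b, f, S, F, hd, hs⟩ := h
  refine ⟨_, _, _, _, _, _, hd.smul c hκ, ?_⟩
  rw [← mul_add]
  exact mul_le_mul_of_nonneg_left hs (norm_nonneg _)

lemma SF.const (ω : Fin r → ℝ) (κ : ℝ) (B : E) : SF ω κ ‖B‖ (fun _ => B) :=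
  ⟨_, _, _, _, _, _, IsD.const κ B, by simp⟩

lemma SF.cont (h : SF ω κ C φ) (hκ : 0 ≤ κ) : Continuous φ := by
  obtain ⟨ι, α, b, f, S, F, hd, hs⟩ := h
  exact hd.φ_cont hκ

lemma SF.bd (h : SF ω κ C φ) (hκ : 0 ≤ κ) (τ : ℝ) (hτ : 0 ≤ τ) : ‖φ τ‖ ≤ C := by
  obtain ⟨ι, α, b, f, S, F, hd, hs⟩ := h
  exact (hd.φ_le hκ τ hτ).trans hs

lemma SF.avg (h : SF ω κ C φ) (hκ : 0 ≤ κ) (hκ' : 0 ≤ κ') (hK : SDB ω κ κ' K) :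
    ∃ m, HasTimeAvg φ m ∧ ‖m‖ ≤ C := by
  obtain ⟨ι, α, b, f, S, F, hd, hs⟩ := h
  exact ⟨_, hd.avg hκ hκ' hK, (hd.norm_mean hκ).trans (by linarith [hd.F_nonneg])⟩

lemma SF.int (h : SF ω κ C φ) (hm : HasTimeAvg φ 0) (hκ : 0 ≤ κ) (hκ' : 0 ≤ κ')
    (hκ'' : 0 ≤ κ'') (hK : SDB ω κ κ' K) (hK' : SDB ω κ' κ'' K') :
    ∃ ψ, SF ω κ' (K * C) ψ ∧ HasTimeAvg ψ 0 ∧ ∀ τ, HasDerivAt ψ (φ τ) τ := by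
  obtain ⟨ι, α, b, f, S, F, hd, hs⟩ := h
  have h0 : meanD α b = 0 := tendsto_nhds_unique (hd.avg hκ hκ' hK) hm
  refine ⟨intD ω α b f, ⟨_, _, _, _, _, _, hd.int hK, ?_⟩, ?_, ?_⟩
  · rw [← mul_add]
    exact mul_le_mul_of_nonneg_left hs (zero_le_one.trans hK.1)
  · have := (hd.int hK).avg hκ' hκ'' hK'
    rwa [mean_intCoef] at this
  · intro τ
    have := hd.int_deriv hκ hκ' hK τ
    rwa [h0, sub_zero] at this

lemma avg_const (B : E) : HasTimeAvg (fun _ : ℝ => B) B := by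
  refine avg_of_antideriv (Ψ := fun _ => 0) (B := 0) continuous_const ?_ ?_
  · intro τ; rw [sub_self]; exact hasDerivAt_const _ _
  · simp

lemma avg_add (hφ : Continuous φ) (hψ : Continuous ψ) (h : HasTimeAvg φ m)
    (h' : HasTimeAvg ψ m') : HasTimeAvg (fun τ => φ τ + ψ τ) (m + m') := by
  unfold HasTimeAvg at *
  refine (h.add h').congr fun T => ?_
  rw [intervalIntegral.integral_add (hφ.intervalIntegrable _ _) (hψ.intervalIntegrable _ _),
    smul_add]

lemma avg_clm (L : E →L[ℝ] E) (hφ : Continuous φ) (h : HasTimeAvg φ m) :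
    HasTimeAvg (fun τ => L (φ τ)) (L m) := by
  unfold HasTimeAvg at *
  refine ((L.continuous.tendsto m).comp h).congr fun T => ?_
  rw [L.intervalIntegral_comp_comm (hφ.intervalIntegrable _ _)]
  simp

lemma avg_mul_const (B : E) (hφ : Continuous φ) (h : HasTimeAvg φ m) :
    HasTimeAvg (fun τ => φ τ * B) (m * B) :=
  avg_clm ((ContinuousLinearMap.mul ℝ E).flip B) hφ h

lemma avg_smul (c : ℂ) (hφ : Continuous φ) (h : HasTimeAvg φ m) :
    HasTimeAvg (fun τ => c • φ τ) (c • m) := by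
  have := avg_clm ((c • ContinuousLinearMap.id ℂ E).restrictScalars ℝ) hφ h
  simpa using this

end SFsec

/-- The approximate solutions of the homological equation. -/
lemma iter {r : ℕ} (ω : Fin r → ℝ) (hSDB : ∀ κ κ' : ℝ, κ' < κ → ∃ K, SDB ω κ κ' K)
    (h1 : ‖(1 : E)‖ ≤ 1) (μ M : ℝ) (hμ : 0 < μ) (hM : 0 < M) (k : ℕ) :
    ∃ Q R κ : ℝ, 0 ≤ Q ∧ 0 ≤ R ∧ 0 < κ ∧ κ ≤ μ ∧ ∀ a : ℝ → E, SF ω μ M a →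
      ∀ ε : ℝ, 0 < ε → ε ≤ 1 → ∃ (Φ : ℝ → E) (A : E) (δ : ℝ → E),
        SF ω κ (Q * ε ^ k) δ ∧ SF ω κ (R * ε) (fun τ => Φ τ - 1) ∧ HasTimeAvg Φ 1 ∧
        HasTimeAvg (fun τ => a τ * Φ τ) A ∧ HasTimeAvg δ 0 ∧ ‖A‖ ≤ M * (1 + R * ε) ∧
        ∀ τ, HasDerivAt Φ ((ε : ℂ) • (a τ * Φ τ - Φ τ * A + δ τ)) τ := by
  induction k with
  | zero =>
    refine ⟨2 * M, 0, μ, by positivity, le_rfl, hμ, le_rfl, fun a ha ε hε hε1 => ?_⟩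
    obtain ⟨K, hK⟩ := hSDB μ (μ / 2) (by linarith)
    obtain ⟨A, hA, hAM⟩ := ha.avg hμ.le (by positivity) hK
    have ha0 := ha.cont hμ.le
    refine ⟨fun _ => 1, A, fun τ => (-1 : ℂ) • a τ + A, ?_, ?_, avg_const 1, ?_, ?_, ?_, ?_⟩
    · refine ((ha.smul (-1) hμ.le).add (SF.const ω μ A) hμ.le).le ?_
      simp only [norm_neg, norm_one, one_mul, pow_zero, mul_one]
      linarith
    · simpa using SF.const ω μ (0 : E)
    · simpa using hA
    · simpa using avg_add (ha0.const_smul (-1 : ℂ)) continuous_const (avg_smul (-1) ha0 hA)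
        (avg_const A)
    · simpa using hAM
    · intro τ
      have : (ε : ℂ) • (a τ * 1 - 1 * A + ((-1 : ℂ) • a τ + A)) = 0 := by simp
      rw [this]
      exact hasDerivAt_const _ _
  | succ k ih =>
    obtain ⟨Q, R, κ, hQ, hR, hκ, hκμ, ih⟩ := ih
    obtain ⟨K, hK⟩ := hSDB κ (κ / 2) (by linarith)
    obtain ⟨K', hK'⟩ := hSDB (κ / 2) (κ / 4) (by linarith)
    have hK0 : 0 ≤ K := zero_le_one.trans hK.1
    have hκ2 : 0 ≤ κ / 2 := by positivity
    set R' := R + K * Q with hR'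
    have hR'0 : 0 ≤ R' := by positivity
    refine ⟨K * Q * M * (1 + (1 + R') + (1 + R)), R', κ / 2, by positivity, hR'0, by positivity,
      by linarith, fun a ha ε hε hε1 => ?_⟩
    obtain ⟨Φ, A, δ, hδ, hΦ, hΦ1, hA, hδ0, hAM, hder⟩ := ih a ha ε hε hε1
    obtain ⟨I, hI, hI0, hId⟩ := hδ.int hδ0 hκ.le hκ2 (by positivity : 0 ≤ κ / 4) hK hK'
    have haκ : SF ω (κ / 2) M a := ha.mono (by linarith)
    have ha0 := ha.cont hμ.le
    have hI_c := hI.cont hκ2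
    -- the correction
    set D : ℝ → E := fun τ => (-(ε : ℂ)) • I τ with hD
    set d : ℝ := K * Q * ε ^ (k + 1) with hd
    have hd0 : 0 ≤ d := by positivity
    have hDS : SF ω (κ / 2) d D := by
      refine (hI.smul (-(ε : ℂ)) hκ2).le (le_of_eq ?_)
      rw [norm_neg, Complex.norm_real, Real.norm_of_nonneg hε.le, hd]
      ring
    have hDc : Continuous D := hDS.cont hκ2
    have hD0 : HasTimeAvg D 0 := by
      have := avg_smul (-(ε : ℂ)) hI_c hI0
      rwa [smul_zero] at this
    have hdε : d ≤ K * Q * ε := by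
      refine mul_le_mul_of_nonneg_left ?_ (by positivity)
      exact pow_le_of_le_one hε.le hε1 (by omega)
    have haD := haκ.mul hDS hκ2
    obtain ⟨B, hB, hBM⟩ := haD.avg hκ2 (by positivity) hK'
    have hΦ2 : SF ω (κ / 2) (R * ε) (fun τ => Φ τ - 1) := hΦ.mono (by linarith)
    have hΦ3 : SF ω (κ / 2) (1 + R) Φ := by
      have := hΦ2.add (SF.const ω (κ / 2) (1 : E)) hκ2
      simp only [sub_add_cancel] at this
      refine this.le ?_
      have : R * ε ≤ R := mul_le_of_le_one_right hR hε1
      linarith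
    have hΦc : Continuous Φ := hΦ3.cont hκ2
    have hΦD : SF ω (κ / 2) (R' * ε) (fun τ => Φ τ + D τ - 1) := by
      have := hΦ2.add hDS hκ2
      have e : (fun τ => Φ τ + D τ - 1) = fun τ => Φ τ - 1 + D τ := by funext τ; abel
      rw [e]
      refine this.le ?_
      rw [hR']; linarith
    have hAB : ‖A + B‖ ≤ M * (1 + R' * ε) := by
      refine (norm_add_le _ _).trans ?_
      have : M * d ≤ M * (K * Q * ε) := mul_le_mul_of_nonneg_left hdε hM.le
      rw [hR']; linarith
    refine ⟨fun τ => Φ τ + D τ, A + B,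
      fun τ => (-1 : ℂ) • (a τ * D τ) + D τ * (A + B) + Φ τ * B, ?_, hΦD, ?_, ?_, ?_, hAB, ?_⟩
    · have s1 := haD.smul (-1) hκ2
      have s2 := hDS.mul (SF.const ω (κ / 2) (A + B)) hκ2
      have s3 := hΦ3.mul (SF.const ω (κ / 2) B) hκ2
      refine ((s1.add s2 hκ2).add s3 hκ2).le ?_
      have t2 : d * ‖A + B‖ ≤ d * (M * (1 + R')) := by
        refine mul_le_mul_of_nonneg_left (hAB.trans ?_) hd0
        have : R' * ε ≤ R' := mul_le_of_le_one_right hR'0 hε1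
        gcongr
      have t3 : (1 + R) * ‖B‖ ≤ (1 + R) * (M * d) := by gcongr
      rw [norm_neg, norm_one, one_mul]
      calc _ ≤ M * d + d * (M * (1 + R')) + (1 + R) * (M * d) := by linarith
        _ = _ := by rw [hd]; ring
    · simpa using avg_add hΦc hDc hΦ1 hD0
    · have := avg_add (ha0.mul hΦc) (ha0.mul hDc) hA hB
      have e : (fun τ => a τ * (Φ τ + D τ)) = fun τ => (a * Φ) τ + (a * D) τ := by
        funext τ; simp [mul_add]
      rw [e]
      exact this
    · have t1 := avg_smul (-1) (ha0.mul hDc) hB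
      have t2 := avg_mul_const (A + B) hDc hD0
      have t3 := avg_mul_const B hΦc hΦ1
      have c1 : Continuous fun τ => (-1 : ℂ) • (a τ * D τ) := (ha0.mul hDc).const_smul _
      have c2 : Continuous fun τ => D τ * (A + B) := hDc.mul continuous_const
      have c3 : Continuous fun τ => Φ τ * B := hΦc.mul continuous_const
      have := avg_add (c1.add c2) c3 (avg_add c1 c2 t1 t2) t3
      simpa using this
    · intro τ
      have hDd : HasDerivAt D ((-(ε : ℂ)) • δ τ) τ := (hId τ).const_smul (-(ε : ℂ))
      have := (hder τ).add hDd
      have e : (ε : ℂ) • (a τ * (Φ τ + D τ) - (Φ τ + D τ) * (A + B) +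
          ((-1 : ℂ) • (a τ * D τ) + D τ * (A + B) + Φ τ * B)) =
          (ε : ℂ) • (a τ * Φ τ - Φ τ * A + δ τ) + (-(ε : ℂ)) • δ τ := by
        rw [neg_smul (ε : ℂ) (δ τ), ← sub_eq_add_neg, ← smul_sub]
        congr 1
        rw [neg_one_smul]
        noncomm_ring
      rw [e]
      exact this

lemma avg_congr {φ ψ : ℝ → E} {m : E} (h : HasTimeAvg φ m) (e : ∀ τ, 0 ≤ τ → ψ τ = φ τ) :
    HasTimeAvg ψ m := by
  unfold HasTimeAvg at *
  refine h.congr' ?_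
  filter_upwards [eventually_ge_atTop 0] with T hT
  congr 1
  refine intervalIntegral.integral_congr fun τ hτ => ?_
  rw [Set.uIcc_of_le hT] at hτ
  exact (e τ hτ.1).symm

lemma main_abs {r : ℕ} (ω : Fin r → ℝ) (hSDB : ∀ κ κ' : ℝ, κ' < κ → ∃ K, SDB ω κ κ' K)
    (h1 : ‖(1 : E)‖ ≤ 1) (μ M c : ℝ) (hμ : 0 < μ) (hM : 0 < M) (hc0 : 0 < c) (n : ℕ) :
    ∃ εn : ℝ, 0 < εn ∧ ∀ a a' : ℝ → E, SF ω μ M a' → (∀ τ, 0 ≤ τ → a τ = a' τ) →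
        ∀ ε : ℝ, 0 < ε → ε ≤ εn →
          ∃ (Φ Φ' : ℝ → E) (A : E),
            (∀ τ : ℝ, 0 ≤ τ → HasDerivWithinAt Φ (Φ' τ) (Set.Ici 0) τ) ∧
            ContinuousOn Φ' (Set.Ici 0) ∧
            HasTimeAvg Φ 1 ∧
            HasTimeAvg (fun τ => a τ * Φ τ) A ∧
            (∀ τ : ℝ, 0 ≤ τ → ‖Φ τ - 1‖ ≤ c * ε / εn) ∧
            c * ε / εn ≤ c ∧
            ‖A‖ ≤ (1 + c) * M ∧
            HasTimeAvg (fun τ => ε⁻¹ • Φ' τ - (a τ * Φ τ - Φ τ * A)) 0 ∧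
            (∀ τ : ℝ, 0 ≤ τ →
              ‖ε⁻¹ • Φ' τ - (a τ * Φ τ - Φ τ * A)‖ ≤ M * (ε / εn) ^ n) ∧
            (∀ τ : ℝ, 0 ≤ τ →
              ‖ε • ∫ σ in (0:ℝ)..τ, (ε⁻¹ • Φ' σ - (a σ * Φ σ - Φ σ * A))‖ ≤
                (ε / εn) ^ (n + 1)) := by
  obtain ⟨Q, R, κ, hQ, hR, hκ, hκμ, ih⟩ := iter ω hSDB h1 μ M hμ hM (n + 1)
  obtain ⟨K, hK⟩ := hSDB κ (κ / 2) (by linarith)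
  obtain ⟨K', hK'⟩ := hSDB (κ / 2) (κ / 4) (by linarith)
  have hK0 : 0 ≤ K := zero_le_one.trans hK.1
  have hκ2 : 0 ≤ κ / 2 := by positivity
  obtain ⟨εn, hεn, g1, g2, g3, g4⟩ : ∃ εn : ℝ, 0 < εn ∧ εn ≤ 1 ∧ R * εn ≤ c ∧ Q * εn ≤ M ∧
      2 * (K * Q) * εn ≤ 1 := by
    have key : ∀ p q : ℝ, 0 ≤ p → 0 < q → ∀ x ≤ q / (p + 1), 0 < x → p * x ≤ q := by
      intro p q hp hq x hx hx0
      rw [le_div_iff₀ (by positivity)] at hx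
      nlinarith
    refine ⟨min (min 1 (c / (R + 1))) (min (M / (Q + 1)) (1 / (2 * (K * Q) + 1))), ?_, ?_, ?_, ?_, ?_⟩
    · have : 0 < 2 * (K * Q) + 1 := by positivity
      positivity
    · exact (min_le_left _ _).trans (min_le_left _ _)
    · exact key _ _ hR hc0 _ ((min_le_left _ _).trans (min_le_right _ _)) (by positivity)
    · exact key _ _ hQ hM _ ((min_le_right _ _).trans (min_le_left _ _)) (by positivity)
    · exact key _ _ (by positivity) one_pos _ ((min_le_right _ _).trans (min_le_right _ _))
        (by positivity)
  refine ⟨εn, hεn, fun a a' ha haa ε hε hεε => ?_⟩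
  have hε1 := hεε.trans g1
  obtain ⟨Φ, A, δ, hδ, hΦ, hΦ1, hA, hδ0, hAM, hder⟩ := ih a' ha ε hε hε1
  obtain ⟨I, hI, hI0, hId⟩ := hδ.int hδ0 hκ.le hκ2 (by positivity : 0 ≤ κ / 4) hK hK'
  have ha0 := ha.cont hμ.le
  have hδc := hδ.cont hκ.le
  have hΦc : Continuous Φ := continuous_iff_continuousAt.2 fun τ => (hder τ).continuousAt
  have hpow : ∀ k : ℕ, ε ^ k ≤ (ε / εn) ^ k := fun k =>
    pow_le_pow_left₀ hε.le (by rw [le_div_iff₀ hεn]; exact mul_le_of_le_one_right hε.le g1) k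
  have hδe : ∀ τ, 0 ≤ τ → ε⁻¹ • ((ε : ℂ) • (a' τ * Φ τ - Φ τ * A + δ τ)) -
      (a τ * Φ τ - Φ τ * A) = δ τ := by
    intro τ hτ
    rw [haa τ hτ, Complex.coe_smul, smul_smul, inv_mul_cancel₀ hε.ne', one_smul]
    abel
  refine ⟨Φ, fun τ => (ε : ℂ) • (a' τ * Φ τ - Φ τ * A + δ τ), A, fun τ _ =>
    (hder τ).hasDerivWithinAt, ?_, hΦ1, ?_, ?_, ?_, ?_, ?_, ?_, ?_⟩
  · refine Continuous.continuousOn ?_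
    exact (((ha0.mul hΦc).sub (hΦc.mul continuous_const)).add hδc).const_smul _
  · exact avg_congr hA fun τ hτ => by rw [haa τ hτ]
  · intro τ hτ
    refine (hΦ.bd hκ.le τ hτ).trans ?_
    rw [le_div_iff₀ hεn]
    nlinarith
  · rw [div_le_iff₀ hεn]
    exact mul_le_mul_of_nonneg_left hεε hc0.le
  · refine hAM.trans ?_
    have : R * ε ≤ c := (mul_le_mul_of_nonneg_left hεε hR).trans g2
    nlinarith
  · exact avg_congr hδ0 hδe
  · intro τ hτ
    rw [hδe τ hτ]
    refine (hδ.bd hκ.le τ hτ).trans ?_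
    calc Q * ε ^ (n + 1) = (Q * ε) * ε ^ n := by ring
      _ ≤ M * (ε / εn) ^ n := mul_le_mul ((mul_le_mul_of_nonneg_left hεε hQ).trans g3) (hpow n)
        (by positivity) hM.le
  · intro τ hτ
    have e : ∫ σ in (0:ℝ)..τ, (ε⁻¹ • ((ε : ℂ) • (a' σ * Φ σ - Φ σ * A + δ σ)) -
        (a σ * Φ σ - Φ σ * A)) = I τ - I 0 := by
      rw [← intervalIntegral.integral_eq_sub_of_hasDerivAt (fun t _ => hId t)
        (hδc.intervalIntegrable _ _)]
      refine intervalIntegral.integral_congr fun t ht => ?_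
      rw [Set.uIcc_of_le hτ] at ht
      exact hδe t ht.1
    rw [e, norm_smul, Real.norm_of_nonneg hε.le]
    have b1 := (norm_sub_le (I τ) (I 0)).trans
      (add_le_add (hI.bd hκ2 τ hτ) (hI.bd hκ2 0 le_rfl))
    calc ε * ‖I τ - I 0‖ ≤ ε * (K * (Q * ε ^ (n + 1)) + K * (Q * ε ^ (n + 1))) := by gcongr
      _ = (2 * (K * Q) * ε) * ε ^ (n + 1) := by ring
      _ ≤ 1 * (ε / εn) ^ (n + 1) := mul_le_mul
        ((mul_le_mul_of_nonneg_left hεε (by positivity)).trans g4) (hpow _) (by positivity)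
        zero_le_one
      _ = _ := one_mul _

end Aux

lemma SF_of_IsSharpFlat {r : ℕ} {ω : Fin r → ℝ} {μ M : ℝ} {a : ℝ → (X →L[ℂ] X)}
    {ahat : (Fin r → ℤ) → (X →L[ℂ] X)} {aflat : ℝ → (X →L[ℂ] X)}
    (h : IsSharpFlat ω μ a ahat aflat) (hM : SFNorm μ ahat aflat ≤ M) :
    SF ω μ M (fun τ => sharpSum ω ahat τ + aflat (max 0 τ)) := by
  refine ⟨Fin r → ℤ, id, ahat, fun τ => aflat (max 0 τ), sharpNorm μ ahat, flatSup aflat,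
    ⟨h.summable, le_rfl, ?_, ?_, fun τ => rfl⟩, hM⟩
  · exact h.flat_cont.comp_continuous (by fun_prop) fun τ => Set.mem_Ici.2 (le_max_left _ _)
  · intro τ hτ
    have := le_ciSup h.flat_bdd ⟨τ, hτ⟩
    simp only at this
    rw [max_eq_right hτ, Real.exp_neg, ← div_eq_mul_inv, le_div_iff₀ (Real.exp_pos _), mul_comm]
    exact this

/-- well-posedness of the micro-macro decomposition,
Theorem 2.7 of the paper. Under the Diophantine condition, for every `n ∈ ℕ`
there exists `ε_n > 0`, independent of `a` and of `ε`, such that for every sharp-flat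
map `a` of class `μ` with `𝒩_μ(a) ≤ M` and every `0 < ε ≤ ε_n` there exist a `C¹` map
`Φ : [0,∞) → End(X)` (with derivative `Φ'`) and `A ∈ End(X)` with `⟨Φ⟩ = id`,
`A = ⟨aΦ⟩`, `‖Φ − id‖ ≤ cε/ε_n ≤ c`, `|A| ≤ (1+c)M`, and whose defect
`δ_τ = ε⁻¹∂_τΦ_τ − (a_τΦ_τ − Φ_τA)` has zero time average and satisfies
`‖δ‖ ≤ M(ε/ε_n)^n` and `|ε∫₀^τ δ| ≤ (ε/ε_n)^{n+1}`. -/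
theorem microMacro_wellPosed
    {r : ℕ} (ω : Fin r → ℝ) (c_D ν : ℝ) (hcD : 0 < c_D) (hν : 0 < ν)
    (hdio : ∀ α : Fin r → ℤ, α ≠ 0 → c_D / (absIdx α) ^ ν ≤ |dotIdx ω α|)
    (μ M c : ℝ) (hμ : 0 < μ) (hM : 0 < M) (hc0 : 0 < c) (hc1 : c < 1) :
    ∀ n : ℕ, ∃ εn : ℝ, 0 < εn ∧
      ∀ (a : ℝ → (X →L[ℂ] X))
        (ahat : (Fin r → ℤ) → (X →L[ℂ] X)) (aflat : ℝ → (X →L[ℂ] X)),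
        IsSharpFlat ω μ a ahat aflat → SFNorm μ ahat aflat ≤ M →
        ∀ ε : ℝ, 0 < ε → ε ≤ εn →
          ∃ (Φ Φ' : ℝ → (X →L[ℂ] X)) (A : X →L[ℂ] X),
            (∀ τ : ℝ, 0 ≤ τ → HasDerivWithinAt Φ (Φ' τ) (Set.Ici 0) τ) ∧
            ContinuousOn Φ' (Set.Ici 0) ∧
            HasTimeAvg Φ 1 ∧
            HasTimeAvg (fun τ => a τ ∘L Φ τ) A ∧
            (∀ τ : ℝ, 0 ≤ τ → ‖Φ τ - 1‖ ≤ c * ε / εn) ∧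
            c * ε / εn ≤ c ∧
            ‖A‖ ≤ (1 + c) * M ∧
            HasTimeAvg (fun τ => ε⁻¹ • Φ' τ - (a τ ∘L Φ τ - Φ τ ∘L A)) 0 ∧
            (∀ τ : ℝ, 0 ≤ τ →
              ‖ε⁻¹ • Φ' τ - (a τ ∘L Φ τ - Φ τ ∘L A)‖ ≤ M * (ε / εn) ^ n) ∧
            (∀ τ : ℝ, 0 ≤ τ →
              ‖ε • ∫ σ in (0:ℝ)..τ, (ε⁻¹ • Φ' σ - (a σ ∘L Φ σ - Φ σ ∘L A))‖ ≤
                (ε / εn) ^ (n + 1)) := by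
  intro n
  obtain ⟨εn, hεn, H⟩ := main_abs (E := X →L[ℂ] X) ω
    (fun κ κ' hκ => exists_SDB ω c_D ν hcD hν hdio κ κ' hκ)
    ContinuousLinearMap.norm_id_le μ M c hμ hM hc0 n
  refine ⟨εn, hεn, fun a ahat aflat ha hN ε hε hεε => ?_⟩
  exact H a _ (SF_of_IsSharpFlat ha hN)
    (fun τ hτ => by rw [ha.decomp τ hτ, max_eq_right hτ]) ε hε hεε
end
end

section
/- (Boundedness of the micro-macro variables.) Let ε > 0, M_a > 0, M_A ≥ 0, η ≥ 0. Let a : [0,∞) → End(X) be continuous with |a_τ| ≤ M_a for all τ ≥ 0, let A ∈ End(X) with |A| ≤ M_A, and let δ : [0,∞) → End(X) be continuous with |∫_0^t δ_{σ/ε} dσ| ≤ η for all t ≥ 0. Let v₀ ∈ X and let v, w : [0,∞) → X be differentiable with v(0) = v₀, ∂_t v(t) = A v(t), w(0) = 0, and ∂_t w(t) = a_{t/ε} w(t) − δ_{t/ε} v(t). Then for all t ≥ 0: |v(t)| ≤ e^{t M_A}|v₀| and |w(t)| ≤ η e^{t M_a}(2e^{t M_A} − 1)|v₀|. -/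
open MeasureTheory

noncomputable section

/-- Scalar comparison principle for norms of solutions of differential inequalities. -/
theorem norm_le_of_comparison
    {X : Type*} [NormedAddCommGroup X] [NormedSpace ℝ X]
    (f f' : ℝ → X) (B B' g : ℝ → ℝ) (K : ℝ)
    (hf : ∀ t : ℝ, 0 ≤ t → HasDerivWithinAt f (f' t) (Set.Ici 0) t)
    (hf' : ∀ t : ℝ, 0 ≤ t → ‖f' t‖ ≤ K * ‖f t‖ + g t)
    (hB : ∀ t : ℝ, HasDerivAt B (B' t) t)
    (hB' : ∀ t : ℝ, 0 ≤ t → K * B t + g t ≤ B' t)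
    (h0 : ‖f 0‖ ≤ B 0) (t : ℝ) (ht : 0 ≤ t) : ‖f t‖ ≤ B t := by
  have key : ∀ r : ℝ, 0 < r → ‖f t‖ ≤ B t + r * Real.exp (t * (K + 1)) := by
    intro r hr
    have hd : ∀ x : ℝ, HasDerivAt (fun x => B x + r * Real.exp (x * (K + 1)))
        (B' x + r * (Real.exp (x * (K + 1)) * (1 * (K + 1)))) x := fun x =>
      (hB x).add ((((hasDerivAt_id x).mul_const (K + 1)).exp).const_mul r)
    refine image_norm_le_of_norm_deriv_right_lt_deriv_boundary' (a := 0) (b := t) (f := f)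
      (f' := f') (B := fun x => B x + r * Real.exp (x * (K + 1)))
      (B' := fun x => B' x + r * (Real.exp (x * (K + 1)) * (1 * (K + 1))))
      ?_ ?_ ?_ ?_ ?_ ?_ (Set.right_mem_Icc.2 ht)
    · intro x hx
      exact (hf x hx.1).continuousWithinAt.mono Set.Icc_subset_Ici_self
    · intro x hx
      exact (hf x hx.1).mono (Set.Ici_subset_Ici.2 hx.1)
    · have : 0 < r * Real.exp (0 * (K + 1)) := by positivity
      linarith
    · intro x _
      exact (hd x).continuousAt.continuousWithinAt
    · intro x _
      exact (hd x).hasDerivWithinAt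
    · intro x hx heq
      have h1 := hf' x hx.1
      have h2 := hB' x hx.1
      have h3 : 0 < r * Real.exp (x * (K + 1)) := by positivity
      rw [heq] at h1
      nlinarith
  refine le_of_forall_pos_le_add fun e he => ?_
  have := key (e / Real.exp (t * (K + 1))) (by positivity)
  rwa [div_mul_cancel₀ _ (Real.exp_pos _).ne'] at this

/-- boundedness of the micro-macro variables. If `|a_τ| ≤ M_a`,
`|A| ≤ M_A`, `|∫₀^t δ_{σ/ε} dσ| ≤ η` for all `t ≥ 0`, `v` solves `∂_t v = A v` with
`v(0) = v₀` and `w` solves `∂_t w = a_{t/ε} w − δ_{t/ε} v` with `w(0) = 0`, then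
`|v(t)| ≤ e^{tM_A}|v₀|` and `|w(t)| ≤ η e^{tM_a}(2e^{tM_A} − 1)|v₀|` for all `t ≥ 0`. -/
theorem microMacro_bounds
    {X : Type*} [NormedAddCommGroup X] [NormedSpace ℂ X] [CompleteSpace X]
    (ε Ma MA η : ℝ) (hε : 0 < ε) (hMa : 0 < Ma) (hMA : 0 ≤ MA) (hη : 0 ≤ η)
    (a : ℝ → (X →L[ℂ] X)) (hacont : ContinuousOn a (Set.Ici 0))
    (habd : ∀ τ : ℝ, 0 ≤ τ → ‖a τ‖ ≤ Ma)
    (A : X →L[ℂ] X) (hA : ‖A‖ ≤ MA)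
    (δ : ℝ → (X →L[ℂ] X)) (hδc : ContinuousOn δ (Set.Ici 0))
    (hδint : ∀ t : ℝ, 0 ≤ t → ‖∫ σ in (0:ℝ)..t, δ (σ / ε)‖ ≤ η)
    (v₀ : X) (v w : ℝ → X) (hv0 : v 0 = v₀) (hw0 : w 0 = 0)
    (hv : ∀ t : ℝ, 0 ≤ t → HasDerivWithinAt v (A (v t)) (Set.Ici 0) t)
    (hw : ∀ t : ℝ, 0 ≤ t →
      HasDerivWithinAt w ((a (t / ε)) (w t) - (δ (t / ε)) (v t)) (Set.Ici 0) t) :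
    ∀ t : ℝ, 0 ≤ t →
      ‖v t‖ ≤ Real.exp (t * MA) * ‖v₀‖ ∧
      ‖w t‖ ≤ η * Real.exp (t * Ma) * (2 * Real.exp (t * MA) - 1) * ‖v₀‖ := by
  have hvb : ∀ t : ℝ, 0 ≤ t → ‖v t‖ ≤ Real.exp (t * MA) * ‖v₀‖ := by
    refine norm_le_of_comparison v (fun t => A (v t)) (fun t => Real.exp (t * MA) * ‖v₀‖)
      (fun t => Real.exp (t * MA) * (1 * MA) * ‖v₀‖) (fun _ => 0) MA hv ?_ ?_ ?_ ?_
    · intro t _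
      rw [add_zero]
      exact A.le_of_opNorm_le hA _
    · intro t
      exact (((hasDerivAt_id t).mul_const MA).exp).mul_const _
    · intro t _
      apply le_of_eq
      ring
    · simp [hv0]
  -- the primitive of the oscillating term, extended to the whole line
  set d : ℝ → (X →L[ℂ] X) := fun s => δ (max s 0 / ε) with hd
  have hdc : Continuous d := by
    refine hδc.comp_continuous (by fun_prop) fun s => ?_
    exact div_nonneg (le_max_right _ _) hε.le
  set D : ℝ → (X →L[ℂ] X) := fun t => ∫ s in (0:ℝ)..t, d s with hD
  have hDd : ∀ t, HasDerivAt D (d t) t := fun t => hdc.integral_hasStrictDerivAt 0 t |>.hasDerivAt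
  have hDb : ∀ t : ℝ, 0 ≤ t → ‖D t‖ ≤ η := by
    intro t ht
    have : D t = ∫ s in (0:ℝ)..t, δ (s / ε) := by
      refine intervalIntegral.integral_congr fun s hs => ?_
      rw [Set.uIcc_of_le ht] at hs
      simp only [hd, max_eq_left hs.1]
    rw [this]
    exact hδint t ht
  have hDv : ∀ t : ℝ, 0 ≤ t →
      HasDerivWithinAt (fun t => D t (v t)) (d t (v t) + D t (A (v t))) (Set.Ici 0) t := by
    intro t ht
    have h1 := (ContinuousLinearMap.restrictScalarsL ℂ X X ℝ ℝ).hasFDerivAt.comp_hasDerivAt t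
      (hDd t)
    exact h1.hasDerivWithinAt.clm_apply (hv t ht)
  have hDvb : ∀ t : ℝ, 0 ≤ t → ‖D t (v t)‖ ≤ η * (Real.exp (t * MA) * ‖v₀‖) := fun t ht =>
    (D t).le_of_opNorm_le_of_le (hDb t ht) (hvb t ht)
  have hzb : ∀ t : ℝ, 0 ≤ t → ‖w t + D t (v t)‖ ≤
      (Real.exp (t * Ma) * (2 * Real.exp (t * MA) - 1) - Real.exp (t * MA)) * (η * ‖v₀‖) := by
    refine norm_le_of_comparison (fun t => w t + D t (v t))
      (fun t => (a (t / ε) (w t) - δ (t / ε) (v t)) + (d t (v t) + D t (A (v t))))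
      (fun t => (Real.exp (t * Ma) * (2 * Real.exp (t * MA) - 1) - Real.exp (t * MA))
        * (η * ‖v₀‖))
      (fun t => ((Real.exp (t * Ma) * (1 * Ma)) * (2 * Real.exp (t * MA) - 1)
        + Real.exp (t * Ma) * (2 * (Real.exp (t * MA) * (1 * MA)))
        - Real.exp (t * MA) * (1 * MA)) * (η * ‖v₀‖))
      (fun t => (Ma + MA) * Real.exp (t * MA) * (η * ‖v₀‖)) Ma
      (fun t ht => (hw t ht).add (hDv t ht)) ?_ ?_ ?_ ?_
    · intro t ht
      have hat : ‖a (t / ε)‖ ≤ Ma := habd _ (div_nonneg ht hε.le)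
      have e : (a (t / ε) (w t) - δ (t / ε) (v t)) + (d t (v t) + D t (A (v t)))
          = a (t / ε) (w t + D t (v t)) - a (t / ε) (D t (v t)) + D t (A (v t)) := by
        simp only [hd, max_eq_left ht, map_add]
        abel
      rw [e]
      have h1 := (a (t / ε)).le_of_opNorm_le hat (w t + D t (v t))
      have h2 := (a (t / ε)).le_of_opNorm_le_of_le hat (hDvb t ht)
      have h3 := (D t).le_of_opNorm_le_of_le (hDb t ht) (A.le_of_opNorm_le_of_le hA (hvb t ht))
      have h4 := norm_add_le (a (t / ε) (w t + D t (v t)) - a (t / ε) (D t (v t))) (D t (A (v t)))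
      have h5 := norm_sub_le (a (t / ε) (w t + D t (v t))) (a (t / ε) (D t (v t)))
      linarith
    · intro t
      have e1 := ((hasDerivAt_id t).mul_const Ma).exp
      have e2 := ((hasDerivAt_id t).mul_const MA).exp
      exact ((e1.mul ((e2.const_mul 2).sub_const 1)).sub e2).mul_const _
    · intro t ht
      have h1 : 1 ≤ Real.exp (t * Ma) := Real.one_le_exp (by positivity)
      have h2 : 0 ≤ (Real.exp (t * Ma) - 1) * (2 * MA * Real.exp (t * MA) * (η * ‖v₀‖)) :=
        mul_nonneg (by linarith) (by positivity)
      linarith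
    · simp [hw0, hD]
      norm_num
  intro t ht
  refine ⟨hvb t ht, ?_⟩
  have h1 := hzb t ht
  have h2 := hDvb t ht
  have h3 := norm_sub_le (w t + D t (v t)) (D t (v t))
  rw [add_sub_cancel_right] at h3
  linarith
end
end

section
/- Let A ∈ End(X) with |A| ≤ M_A, let v : [0,∞) → X be differentiable with ∂_t v(t) = A v(t), and let δ : [0,∞) → End(X) be continuous with |∫_0^t δ(s) ds| ≤ η for all t ≥ 0. Then for every t ≥ 0, |∫_0^t δ(s) v(s) ds| ≤ η (2e^{t M_A} − 1) |v(0)|. -/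
open MeasureTheory

noncomputable section

/-- If `|A| ≤ M_A`, `v` solves `∂_t v = A v`, and the primitive of
`δ` satisfies `|∫₀^t δ| ≤ η` for all `t ≥ 0`, then
`|∫₀^t δ(s) v(s) ds| ≤ η (2e^{tM_A} − 1)|v(0)|` for every `t ≥ 0`. -/
theorem defect_drift_integral_bound
    {X : Type*} [NormedAddCommGroup X] [NormedSpace ℂ X] [CompleteSpace X]
    (MA η : ℝ) (hMA : 0 ≤ MA) (hη : 0 ≤ η)
    (A : X →L[ℂ] X) (hA : ‖A‖ ≤ MA)
    (v : ℝ → X) (hv : ∀ t : ℝ, 0 ≤ t → HasDerivWithinAt v (A (v t)) (Set.Ici 0) t)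
    (δ : ℝ → (X →L[ℂ] X)) (hδc : ContinuousOn δ (Set.Ici 0))
    (hδint : ∀ t : ℝ, 0 ≤ t → ‖∫ s in (0:ℝ)..t, δ s‖ ≤ η) :
    ∀ t : ℝ, 0 ≤ t →
      ‖∫ s in (0:ℝ)..t, (δ s) (v s)‖ ≤ η * (2 * Real.exp (t * MA) - 1) * ‖v 0‖ := by
  have hvc : ContinuousOn v (Set.Ici 0) := fun t ht => (hv t ht).continuousWithinAt
  have hmax : Continuous (fun s : ℝ => max s 0) := by fun_prop
  have hmem : ∀ s : ℝ, max s 0 ∈ Set.Ici (0:ℝ) := fun s => le_max_right s 0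
  have hδ' : Continuous (fun s : ℝ => δ (max s 0)) := hδc.comp_continuous hmax hmem
  have hv' : Continuous (fun s : ℝ => v (max s 0)) := hvc.comp_continuous hmax hmem
  have hw : Continuous (fun s : ℝ => δ (max s 0) (v (max s 0))) := hδ'.clm_apply hv'
  have hDd : ∀ t : ℝ, HasDerivAt (fun u : ℝ => ∫ s in (0:ℝ)..u, δ (max s 0)) (δ (max t 0)) t :=
    fun t => hδ'.integral_hasStrictDerivAt 0 t |>.hasDerivAt
  have hWd : ∀ t : ℝ, HasDerivAt (fun u : ℝ => ∫ s in (0:ℝ)..u, δ (max s 0) (v (max s 0)))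
      (δ (max t 0) (v (max t 0))) t :=
    fun t => hw.integral_hasStrictDerivAt 0 t |>.hasDerivAt
  have hDeq : ∀ t : ℝ, 0 ≤ t → ∫ s in (0:ℝ)..t, δ (max s 0) = ∫ s in (0:ℝ)..t, δ s := by
    intro t ht
    refine intervalIntegral.integral_congr fun s hs => ?_
    rw [Set.uIcc_of_le ht] at hs
    simp only [max_eq_left hs.1]
  have hWeq : ∀ t : ℝ, 0 ≤ t → ∫ s in (0:ℝ)..t, δ (max s 0) (v (max s 0))
      = ∫ s in (0:ℝ)..t, δ s (v s) := by
    intro t ht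
    refine intervalIntegral.integral_congr fun s hs => ?_
    rw [Set.uIcc_of_le ht] at hs
    simp only [max_eq_left hs.1]
  have hD : ∀ t : ℝ, 0 ≤ t → ‖∫ s in (0:ℝ)..t, δ (max s 0)‖ ≤ η := by
    intro t ht
    rw [hDeq t ht]
    exact hδint t ht
  have hvd : ∀ t : ℝ, 0 ≤ t → HasDerivWithinAt v (A (v t)) (Set.Ici t) t :=
    fun t ht => (hv t ht).mono (Set.Ici_subset_Ici.2 ht)
  have hAv : ∀ t, ‖A (v t)‖ ≤ MA * ‖v t‖ := fun t => A.le_of_opNorm_le hA _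
  have hgr : ∀ t : ℝ, 0 ≤ t → ‖v t‖ ≤ ‖v 0‖ * Real.exp (MA * t) := by
    intro t ht
    have h := norm_le_gronwallBound_of_norm_deriv_right_le (f := v) (f' := fun s => A (v s))
      (δ := ‖v 0‖) (K := MA) (ε := 0) (a := 0) (b := t)
      (hvc.mono Set.Icc_subset_Ici_self) (fun s hs => hvd s hs.1) le_rfl
      (fun s _ => by simpa using hAv s) t ⟨ht, le_rfl⟩
    simpa [gronwallBound_ε0] using h
  intro t ht
  let D : ℝ → (X →L[ℂ] X) := fun u => ∫ s in (0:ℝ)..u, δ (max s 0)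
  let W : ℝ → X := fun u => ∫ s in (0:ℝ)..u, δ (max s 0) (v (max s 0))
  have hDv : ∀ s : ℝ, 0 ≤ s →
      HasDerivWithinAt (fun u => D u (v u)) (δ s (v s) + D s (A (v s))) (Set.Ici 0) s := by
    intro s hs
    have h1 : HasDerivWithinAt D (δ (max s 0)) (Set.Ici 0) s := (hDd s).hasDerivWithinAt
    rw [max_eq_left hs] at h1
    have h2 := (ContinuousLinearMap.restrictScalarsL ℂ X X ℝ ℝ).hasFDerivAt.comp_hasDerivWithinAt
      s h1
    exact h2.clm_apply (hv s hs)
  have hf : ∀ s : ℝ, 0 ≤ s →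
      HasDerivWithinAt (fun u => D u (v u) - W u) (D s (A (v s))) (Set.Ici 0) s := by
    intro s hs
    have h1 : HasDerivWithinAt W _ (Set.Ici 0) s := (hWd s).hasDerivWithinAt
    rw [max_eq_left hs] at h1
    have := (hDv s hs).sub h1
    rwa [add_sub_cancel_left] at this
  have key : ‖D t (v t) - W t‖ ≤ η * ‖v 0‖ * (Real.exp (MA * t) - 1) := by
    refine image_norm_le_of_norm_deriv_right_le_deriv_boundary
      (f := fun u => D u (v u) - W u) (f' := fun s => D s (A (v s))) (a := 0) (b := t)
      (B := fun u => η * ‖v 0‖ * (Real.exp (MA * u) - 1))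
      (B' := fun u => η * ‖v 0‖ * (Real.exp (MA * u) * MA))
      (fun s hs => ((hf s hs.1).continuousWithinAt).mono Set.Icc_subset_Ici_self)
      (fun s hs => (hf s hs.1).mono (Set.Ici_subset_Ici.2 hs.1)) ?_ ?_ ?_ ⟨ht, le_rfl⟩
    · simp [D, W]
    · intro s
      have h0 : HasDerivAt (fun u : ℝ => MA * u) MA s := by
        simpa using (hasDerivAt_id s).const_mul MA
      exact (h0.exp.sub_const 1).const_mul _
    · intro s hs
      calc ‖D s (A (v s))‖ ≤ η * ‖A (v s)‖ := (D s).le_of_opNorm_le (hD s hs.1) _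
        _ ≤ η * (MA * (‖v 0‖ * Real.exp (MA * s))) := by
          gcongr
          exact (hAv s).trans (by gcongr; exact hgr s hs.1)
        _ = _ := by ring
  have h3 : ‖D t (v t)‖ ≤ η * (‖v 0‖ * Real.exp (MA * t)) :=
    ((D t).le_of_opNorm_le (hD t ht) _).trans (by gcongr; exact hgr t ht)
  rw [← hWeq t ht]
  have h4 : ‖W t‖ ≤ ‖D t (v t)‖ + ‖D t (v t) - W t‖ := by
    have := norm_sub_le (D t (v t)) (D t (v t) - W t)
    rwa [sub_sub_cancel] at this
  change ‖W t‖ ≤ _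
  rw [mul_comm t MA]
  linarith
end
end

section
/- Assume ω ∈ ℝ^r is nonresonant (α·ω = 0 implies α = 0 for α ∈ ℤ^r). Let κ ≥ 0, q ∈ ℕ, M > 0, C_a > 0, c ∈ (0,1). Let a : [0,∞) → End(X) be sharp-flat of class κ with 𝒩_κ(a) ≤ M, of class C^q with sup_{0≤p≤q} sup_{τ≥0} |∂_τ^p a_τ| ≤ C_a M. Let φ : [0,∞) → End(X) be sharp-flat of class κ and of class C^q with 𝒩_κ(φ − id) ≤ c. Then Λ{φ}_τ := a_τ φ_τ − φ_τ ⟨aφ⟩ is C^q and sup_{0≤p≤q} sup_{τ≥0} |∂_τ^p Λ{φ}_τ| ≤ (2^q C_a + 1 + c) M · sup_{0≤p≤q} sup_{τ≥0} |∂_τ^p φ_τ|. -/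
open scoped BigOperators
open Filter MeasureTheory

noncomputable section

variable {X : Type*} [NormedAddCommGroup X] [NormedSpace ℂ X] [CompleteSpace X]

theorem sharpSum_norm_le {r : ℕ} (ω : Fin r → ℝ) {κ : ℝ} (hκ : 0 ≤ κ)
    (f : (Fin r → ℤ) → (X →L[ℂ] X))
    (hf : Summable fun α : Fin r → ℤ => Real.exp (κ * absIdx α) * ‖f α‖) (τ : ℝ) :
    (Summable fun α : Fin r → ℤ =>
      Complex.exp (Complex.I * (dotIdx ω α : ℂ) * (τ : ℂ)) • f α) ∧
    ‖sharpSum ω f τ‖ ≤ sharpNorm κ f := by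
  have key : ∀ α : Fin r → ℤ,
      ‖Complex.exp (Complex.I * (dotIdx ω α : ℂ) * (τ : ℂ)) • f α‖ ≤
        Real.exp (κ * absIdx α) * ‖f α‖ := by
    intro α
    have h1 : ‖Complex.exp (Complex.I * (dotIdx ω α : ℂ) * (τ : ℂ))‖ = 1 := by
      rw [Complex.norm_exp]
      simp
    have h2 : (0:ℝ) ≤ κ * absIdx α :=
      mul_nonneg hκ (Finset.sum_nonneg fun i _ => abs_nonneg _)
    rw [norm_smul, h1]
    exact mul_le_mul_of_nonneg_right (Real.one_le_exp h2) (norm_nonneg _)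
  exact ⟨Summable.of_norm_bounded hf key, tsum_of_norm_bounded hf.hasSum key⟩

theorem flat_norm_le (f : ℝ → (X →L[ℂ] X))
    (hf : BddAbove (Set.range fun τ : Set.Ici (0:ℝ) => Real.exp (τ : ℝ) * ‖f (τ : ℝ)‖))
    (τ : ℝ) (hτ : 0 ≤ τ) : ‖f τ‖ ≤ flatSup f := by
  have h := le_ciSup hf ⟨τ, hτ⟩
  have h2 : ‖f τ‖ ≤ Real.exp τ * ‖f τ‖ :=
    le_mul_of_one_le_left (norm_nonneg _) (Real.one_le_exp hτ)
  exact h2.trans h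

/-- bounds on the derivatives of `Λ`. If `a` is sharp-flat of class
`κ` with `𝒩_κ(a) ≤ M`, of class `C^q` on `[0,∞)` with `sup_{p≤q}‖∂^p a‖ ≤ C_a M`, and
`φ` is sharp-flat of class `κ`, of class `C^q`, with `𝒩_κ(φ − id) ≤ c`, then
`Λ{φ} = aφ − φ⟨aφ⟩` is `C^q` and
`sup_{p≤q}‖∂^p Λ{φ}‖ ≤ (2^q C_a + 1 + c) M sup_{p≤q}‖∂^p φ‖`. -/
theorem Lambda_deriv_bound
    {r : ℕ} (ω : Fin r → ℝ)
    (hres : ∀ α : Fin r → ℤ, dotIdx ω α = 0 → α = 0)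
    {κ : ℝ} (hκ : 0 ≤ κ) (q : ℕ) (M C_a c : ℝ)
    (hM : 0 < M) (hCa : 0 < C_a) (hc0 : 0 < c) (hc1 : c < 1)
    (a : ℝ → (X →L[ℂ] X))
    (ahat : (Fin r → ℤ) → (X →L[ℂ] X)) (aflat : ℝ → (X →L[ℂ] X))
    (ha : IsSharpFlat ω κ a ahat aflat) (haM : SFNorm κ ahat aflat ≤ M)
    (haq : ContDiffOn ℝ (q : ℕ∞) a (Set.Ici 0))
    (habd : ∀ p ≤ q, ∀ τ : ℝ, 0 ≤ τ →
      ‖iteratedDerivWithin p a (Set.Ici 0) τ‖ ≤ C_a * M)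
    (φ : ℝ → (X →L[ℂ] X))
    (φhat : (Fin r → ℤ) → (X →L[ℂ] X)) (φflat : ℝ → (X →L[ℂ] X))
    (hφ : IsSharpFlat ω κ φ φhat φflat)
    (hφq : ContDiffOn ℝ (q : ℕ∞) φ (Set.Ici 0))
    (hφc : SFNorm κ (fun α => if α = 0 then φhat 0 - 1 else φhat α) φflat ≤ c)
    (Cφ : ℝ)
    (hCφ : ∀ p ≤ q, ∀ τ : ℝ, 0 ≤ τ →
      ‖iteratedDerivWithin p φ (Set.Ici 0) τ‖ ≤ Cφ)
    (B : X →L[ℂ] X) (hB : HasTimeAvg (fun τ => a τ ∘L φ τ) B) :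
    ContDiffOn ℝ (q : ℕ∞) (fun τ => a τ ∘L φ τ - φ τ ∘L B) (Set.Ici 0) ∧
      ∀ p ≤ q, ∀ τ : ℝ, 0 ≤ τ →
        ‖iteratedDerivWithin p (fun τ => a τ ∘L φ τ - φ τ ∘L B) (Set.Ici 0) τ‖ ≤
          (2 ^ q * C_a + 1 + c) * M * Cφ := by
  have hA : ∀ τ : ℝ, 0 ≤ τ → ‖a τ‖ ≤ M := by
    intro τ hτ
    rw [ha.decomp τ hτ]
    exact (norm_add_le _ _).trans ((add_le_add (sharpSum_norm_le ω hκ ahat ha.summable τ).2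
      (flat_norm_le aflat ha.flat_bdd τ hτ)).trans haM)
  have hP : ∀ τ : ℝ, 0 ≤ τ → ‖φ τ‖ ≤ 1 + c := by
    intro τ hτ
    set g : (Fin r → ℤ) → (X →L[ℂ] X) := fun α => if α = 0 then φhat 0 - 1 else φhat α with hg
    have hgs : Summable fun α : Fin r → ℤ => Real.exp (κ * absIdx α) * ‖g α‖ := by
      have := hφ.summable.update 0 (Real.exp (κ * absIdx (0 : Fin r → ℤ)) * ‖g 0‖)
      refine this.congr fun α => ?_
      by_cases h : α = 0
      · subst h; simp
      · simp [hg, h]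
    have hφs := (sharpSum_norm_le ω hκ φhat hφ.summable τ).1
    obtain ⟨hg1, hg2⟩ := sharpSum_norm_le ω hκ g hgs τ
    have hdiff : sharpSum ω φhat τ - sharpSum ω g τ = 1 := by
      unfold sharpSum
      rw [← hφs.tsum_sub hg1, tsum_eq_single 0]
      · simp [hg, dotIdx]
      · intro α h
        simp [hg, h]
    have e : φ τ = 1 + (sharpSum ω g τ + φflat τ) := by
      rw [hφ.decomp τ hτ, ← hdiff]
      abel
    rw [e]
    refine (norm_add_le _ _).trans (add_le_add ContinuousLinearMap.norm_id_le ?_)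
    exact (norm_add_le _ _).trans ((add_le_add hg2
      (flat_norm_le φflat hφ.flat_bdd τ hτ)).trans hφc)
  have hBn : ‖B‖ ≤ M * (1 + c) := by
    refine le_of_tendsto hB.norm ?_
    filter_upwards [eventually_gt_atTop (0:ℝ)] with T hT
    have h := intervalIntegral.norm_integral_le_of_norm_le_const (a := (0:ℝ)) (b := T)
      (f := fun τ => a τ ∘L φ τ) (C := M * (1 + c)) (by
        intro x hx
        rw [Set.uIoc_of_le hT.le] at hx
        exact (ContinuousLinearMap.opNorm_comp_le _ _).trans
          (mul_le_mul (hA x hx.1.le) (hP x hx.1.le) (norm_nonneg _) hM.le))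
    rw [norm_smul]
    rw [sub_zero, abs_of_pos hT] at h
    have h3 : ‖(1 / T : ℝ)‖ = 1 / T := by
      rw [Real.norm_eq_abs, abs_of_pos (by positivity)]
    rw [h3]
    calc 1 / T * _ ≤ 1 / T * (M * (1 + c) * T) := by gcongr
      _ = M * (1 + c) := by field_simp
  have hCφ0 : 0 ≤ Cφ := (norm_nonneg _).trans (hCφ 0 (Nat.zero_le _) 0 le_rfl)
  have hU : UniqueDiffOn ℝ (Set.Ici (0:ℝ)) := uniqueDiffOn_Ici 0
  have hm : ContDiffOn ℝ (q : ℕ∞) (fun τ => a τ * φ τ) (Set.Ici 0) := haq.mul hφq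
  let R : (X →L[ℂ] X) →L[ℝ] (X →L[ℂ] X) := (ContinuousLinearMap.mul ℝ (X →L[ℂ] X)).flip B
  have hR : ‖R‖ ≤ ‖B‖ := by
    refine ContinuousLinearMap.opNorm_le_bound _ (norm_nonneg _) fun x => ?_
    rw [mul_comm]
    exact norm_mul_le x B
  have hn : ContDiffOn ℝ (q : ℕ∞) (fun τ => φ τ * B) (Set.Ici 0) := hφq.mul contDiffOn_const
  refine ⟨hm.sub hn, ?_⟩
  intro p hp τ hτ
  have hpq : ((p : ℕ) : WithTop ℕ∞) ≤ ((q : ℕ∞) : WithTop ℕ∞) := by exact_mod_cast hp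
  have e : iteratedDerivWithin p (fun τ => a τ ∘L φ τ - φ τ ∘L B) (Set.Ici 0) τ =
      iteratedDerivWithin p (fun τ => a τ * φ τ) (Set.Ici 0) τ -
      iteratedDerivWithin p (fun τ => φ τ * B) (Set.Ici 0) τ :=
    iteratedDerivWithin_sub hτ hU ((hm τ hτ).of_le hpq) ((hn τ hτ).of_le hpq)
  rw [e]
  have b1 : ‖iteratedDerivWithin p (fun τ => a τ * φ τ) (Set.Ici 0) τ‖ ≤
      2 ^ q * C_a * M * Cφ := by
    have h := norm_iteratedFDerivWithin_mul_le haq hφq hU hτ (n := p) hpq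
    simp only [norm_iteratedFDerivWithin_eq_norm_iteratedDerivWithin] at h
    refine h.trans ?_
    calc _ ≤ ∑ i ∈ Finset.range (p + 1), (p.choose i : ℝ) * (C_a * M) * Cφ := by
          refine Finset.sum_le_sum fun i hi => ?_
          have hi' : i ≤ p := Nat.lt_succ_iff.mp (Finset.mem_range.mp hi)
          have := habd i (hi'.trans hp) τ hτ
          have := hCφ (p - i) ((Nat.sub_le _ _).trans hp) τ hτ
          gcongr
      _ = 2 ^ p * (C_a * M * Cφ) := by
          simp_rw [mul_assoc]
          rw [← Finset.sum_mul]
          congr 1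
          exact_mod_cast Nat.sum_range_choose p
      _ ≤ 2 ^ q * (C_a * M * Cφ) := by
          gcongr
          norm_num
      _ = _ := by ring
  have b2 : ‖iteratedDerivWithin p (fun τ => φ τ * B) (Set.Ici 0) τ‖ ≤
      M * (1 + c) * Cφ := by
    have h := R.norm_iteratedFDerivWithin_comp_left (hφq τ hτ) hU hτ (n := p) hpq
    simp only [norm_iteratedFDerivWithin_eq_norm_iteratedDerivWithin] at h
    refine le_trans h ?_
    exact mul_le_mul (hR.trans hBn) (hCφ p hp τ hτ) (norm_nonneg _) (by positivity)
  calc _ ≤ _ := norm_sub_le _ _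
    _ ≤ _ := add_le_add b1 b2
    _ = _ := by ring
end
end

section
/- (Uniform bounds on the derivatives of the micro-macro variables.) Let n ∈ ℕ, q ∈ ℕ, T > 0, K > 0 and ε ∈ (0,1]. Suppose a : [0,∞) → End(X) is C^q with sup_{0≤p≤q} sup_{τ≥0} |∂_τ^p a_τ| ≤ K; A ∈ End(X) with |A| ≤ K; δ : [0,∞) → End(X) is C^q with sup_{0≤p≤q} sup_{τ≥0} |∂_τ^p δ_τ| ≤ K ε^n and |∫_0^t δ_{σ/ε} dσ| ≤ K ε^{n+1} for all t ≥ 0. Let v, w : [0,∞) → X satisfy ∂_t v(t) = A v(t) with |v(0)| ≤ K, and ∂_t w(t) = a_{t/ε} w(t) − δ_{t/ε} v(t) with w(0) = 0. Then v and w are of class C^{min(n,q)+1} on [0,T], and there exists C > 0 depending only on K, T, n and q (not on ε) such that for every integer 0 ≤ p ≤ min(n,q)+1 and every t ∈ [0,T]: |∂_t^p v(t)| ≤ C and |∂_t^p w(t)| ≤ C ε^{n+1−p}. -/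
open MeasureTheory

noncomputable section

section Helpers

variable {X : Type*} [NormedAddCommGroup X] [NormedSpace ℂ X]

/-- Evaluation of complex operators as a real bilinear map. -/
def mmBil (X : Type*) [NormedAddCommGroup X] [NormedSpace ℂ X] :
    (X →L[ℂ] X) →L[ℝ] X →L[ℝ] X :=
  ContinuousLinearMap.restrictScalarsL ℂ X X ℝ ℝ

lemma mmBil_apply (M : X →L[ℂ] X) (x : X) : mmBil X M x = M x := rfl

lemma mmBil_norm : ‖mmBil X‖ ≤ 1 := by
  refine ContinuousLinearMap.opNorm_le_bound _ zero_le_one fun M => ?_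
  rw [one_mul]
  refine ContinuousLinearMap.opNorm_le_bound _ (norm_nonneg _) fun x => ?_
  exact M.le_opNorm x

lemma mm_contDiff_succ {f g : ℝ → X} {k : ℕ}
    (hf : ∀ t : ℝ, 0 ≤ t → HasDerivWithinAt f (g t) (Set.Ici 0) t)
    (hg : ContDiffOn ℝ k g (Set.Ici 0)) :
    ContDiffOn ℝ (k + 1 : ℕ) f (Set.Ici 0) := by
  push_cast
  rw [contDiffOn_succ_iff_derivWithin (uniqueDiffOn_Ici 0)]
  refine ⟨fun t ht => (hf t ht).differentiableWithinAt, by simp, ?_⟩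
  exact hg.congr fun t ht => (hf t ht).derivWithin (uniqueDiffOn_Ici 0 t ht)

lemma mm_contDiff_apply {b : ℝ → (X →L[ℂ] X)} {f : ℝ → X} {k : ℕ}
    (hb : ContDiffOn ℝ k b (Set.Ici 0)) (hf : ContDiffOn ℝ k f (Set.Ici 0)) :
    ContDiffOn ℝ k (fun t => b t (f t)) (Set.Ici 0) :=
  ((mmBil X).contDiff.comp_contDiffOn hb).clm_apply hf

lemma mm_v_contDiff {A : X →L[ℂ] X} {v : ℝ → X}
    (hv : ∀ t : ℝ, 0 ≤ t → HasDerivWithinAt v (A (v t)) (Set.Ici 0) t) (k : ℕ) :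
    ContDiffOn ℝ k v (Set.Ici 0) := by
  induction k with
  | zero =>
    have hc : ContinuousOn v (Set.Ici 0) := fun t ht => (hv t ht).continuousWithinAt
    simpa [contDiffOn_zero] using hc
  | succ k ih => exact mm_contDiff_succ hv (mm_contDiff_apply contDiffOn_const ih)

lemma mm_w_contDiff {b d : ℝ → (X →L[ℂ] X)} {v w : ℝ → X} {q : ℕ}
    (hb : ContDiffOn ℝ q b (Set.Ici 0)) (hd : ContDiffOn ℝ q d (Set.Ici 0))
    (hv : ∀ k : ℕ, ContDiffOn ℝ k v (Set.Ici 0))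
    (hw : ∀ t : ℝ, 0 ≤ t → HasDerivWithinAt w (b t (w t) - d t (v t)) (Set.Ici 0) t)
    (k : ℕ) (hk : k ≤ q + 1) :
    ContDiffOn ℝ k w (Set.Ici 0) := by
  induction k with
  | zero =>
    have hc : ContinuousOn w (Set.Ici 0) := fun t ht => (hw t ht).continuousWithinAt
    simpa [contDiffOn_zero] using hc
  | succ k ih =>
    have hkq : (k : WithTop ℕ∞) ≤ q := by exact_mod_cast (by omega : k ≤ q)
    exact mm_contDiff_succ hw
      ((mm_contDiff_apply (hb.of_le hkq) (ih (by omega))).sub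
        (mm_contDiff_apply (hd.of_le hkq) (hv k)))

lemma mm_v_iter {A : X →L[ℂ] X} {v : ℝ → X}
    (hv : ∀ t : ℝ, 0 ≤ t → HasDerivWithinAt v (A (v t)) (Set.Ici 0) t) (p : ℕ) :
    ∀ t : ℝ, 0 ≤ t → iteratedDerivWithin p v (Set.Ici 0) t = (A ^ p) (v t) := by
  induction p with
  | zero => intro t ht; simp
  | succ p ih =>
    intro t ht
    rw [iteratedDerivWithin_succ, derivWithin_congr (s := Set.Ici 0) (f := fun t => (A ^ p) (v t))
      (fun x hx => ih x hx) (ih t ht)]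
    have := ((mmBil X (A ^ p)).hasFDerivAt.comp_hasDerivWithinAt t (hv t ht))
    rw [pow_succ]
    exact this.derivWithin (uniqueDiffOn_Ici 0 t ht)

lemma mm_v_bound {A : X →L[ℂ] X} {v : ℝ → X} {K T : ℝ} (hA : ‖A‖ ≤ K)
    (hv : ∀ t : ℝ, 0 ≤ t → HasDerivWithinAt v (A (v t)) (Set.Ici 0) t)
    (hK : 0 < K) (h0 : ‖v 0‖ ≤ K) :
    ∀ t ∈ Set.Icc (0:ℝ) T, ‖v t‖ ≤ K * Real.exp (K * T) := by
  intro t ht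
  have := norm_le_gronwallBound_of_norm_deriv_right_le (f := v) (f' := fun t => A (v t))
    (δ := K) (K := K) (ε := 0) (a := 0) (b := T)
    (fun x hx => ((hv x hx.1).continuousWithinAt).mono Set.Icc_subset_Ici_self)
    (fun x hx => (hv x hx.1).mono (Set.Ici_subset_Ici.2 hx.1)) h0
    (fun x hx => by
      rw [add_zero]
      exact (A.le_opNorm _).trans (by gcongr)) t ht
  rw [gronwallBound_ε0, sub_zero] at this
  refine this.trans ?_
  gcongr
  exact ht.2

lemma mm_scale {F : Type*} [NormedAddCommGroup F] [NormedSpace ℝ F] {a : ℝ → F} {q : ℕ}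
    {ε L : ℝ} (hε : 0 < ε)
    (ha : ContDiffOn ℝ q a (Set.Ici 0))
    (hb : ∀ p ≤ q, ∀ τ : ℝ, 0 ≤ τ → ‖iteratedDerivWithin p a (Set.Ici 0) τ‖ ≤ L) :
    ContDiffOn ℝ q (fun t => a (t / ε)) (Set.Ici 0) ∧
    ∀ p ≤ q, ∀ t : ℝ, 0 ≤ t →
      ‖iteratedDerivWithin p (fun t => a (t / ε)) (Set.Ici 0) t‖ ≤ L / ε ^ p := by
  have hm : Set.MapsTo (fun t : ℝ => ε⁻¹ * t) (Set.Ici 0) (Set.Ici 0) := fun t ht => by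
    have : (0:ℝ) ≤ t := ht
    exact Set.mem_Ici.2 (by positivity)
  have he : (fun t => a (t / ε)) = fun t => a (ε⁻¹ * t) := by
    ext t; rw [div_eq_inv_mul]
  rw [he]
  refine ⟨ha.comp (contDiff_const.mul contDiff_id).contDiffOn hm, fun p hp t ht => ?_⟩
  rw [iteratedDerivWithin_comp_const_smul (n := p) (s := Set.Ici 0) ht (uniqueDiffOn_Ici 0)
    (ha.of_le (by exact_mod_cast hp)) _ hm, norm_smul, norm_pow, norm_inv,
    Real.norm_of_nonneg hε.le, div_eq_inv_mul, inv_pow]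
  gcongr
  exact hb p hp _ (hm ht)

lemma mm_leibniz {b : ℝ → (X →L[ℂ] X)} {f : ℝ → X} {p : ℕ} {t G : ℝ} (ht : 0 ≤ t)
    (hb : ContDiffOn ℝ p b (Set.Ici 0)) (hf : ContDiffOn ℝ p f (Set.Ici 0))
    (hG : ∀ i ≤ p, ‖iteratedDerivWithin i b (Set.Ici 0) t‖ *
      ‖iteratedDerivWithin (p - i) f (Set.Ici 0) t‖ ≤ G) :
    ‖iteratedDerivWithin p (fun t => b t (f t)) (Set.Ici 0) t‖ ≤ 2 ^ p * G := by
  have := (mmBil X).norm_iteratedFDerivWithin_le_of_bilinear_of_le_one (n := p) (N := p)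
    hb hf (uniqueDiffOn_Ici 0) (x := t) ht le_rfl mmBil_norm
  simp only [norm_iteratedFDerivWithin_eq_norm_iteratedDerivWithin, mmBil_apply] at this
  refine this.trans ?_
  have h2 : (2:ℝ) ^ p = ∑ i ∈ Finset.range (p + 1), (p.choose i : ℝ) := by
    exact_mod_cast (Nat.sum_range_choose p).symm
  rw [h2, Finset.sum_mul]
  refine Finset.sum_le_sum fun i hi => ?_
  rw [mul_assoc]
  gcongr
  exact hG i (by simpa [Nat.lt_succ_iff] using hi)

/-- The recursive constants. -/
def mmCst (K M C0 : ℝ) : ℕ → ℝ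
  | 0 => C0
  | p + 1 => mmCst K M C0 p + 2 ^ p * (K * mmCst K M C0 p) + 2 ^ p * (K * M)

lemma mmCst_nonneg {K M C0 : ℝ} (hK : 0 ≤ K) (hM : 0 ≤ M) (hC : 0 ≤ C0) (p : ℕ) :
    0 ≤ mmCst K M C0 p := by
  induction p with
  | zero => exact hC
  | succ p ih => simp only [mmCst]; positivity

lemma mmCst_mono {K M C0 : ℝ} (hK : 0 ≤ K) (hM : 0 ≤ M) (hC : 0 ≤ C0) :
    Monotone (mmCst K M C0) := by
  refine monotone_nat_of_le_succ fun p => ?_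
  have := mmCst_nonneg hK hM hC p
  simp only [mmCst]
  have h1 : 0 ≤ 2 ^ p * (K * mmCst K M C0 p) := by positivity
  have h2 : 0 ≤ 2 ^ p * (K * M) := by positivity
  linarith

lemma mm_w_iter {b d : ℝ → (X →L[ℂ] X)} {v w : ℝ → X} {n q : ℕ} {ε K M C0 t : ℝ}
    (hε : 0 < ε) (hK : 0 ≤ K) (hM : 0 ≤ M) (hC : 0 ≤ C0) (ht : 0 ≤ t)
    (hb : ContDiffOn ℝ q b (Set.Ici 0)) (hd : ContDiffOn ℝ q d (Set.Ici 0))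
    (hbb : ∀ p ≤ q, ‖iteratedDerivWithin p b (Set.Ici 0) t‖ ≤ K / ε ^ p)
    (hdb : ∀ p ≤ q, ‖iteratedDerivWithin p d (Set.Ici 0) t‖ ≤ K * ε ^ n / ε ^ p)
    (hv : ∀ k : ℕ, ContDiffOn ℝ k v (Set.Ici 0))
    (hvb : ∀ p ≤ n, ‖iteratedDerivWithin p v (Set.Ici 0) t‖ ≤ M)
    (hε1 : ε ≤ 1)
    (hw : ∀ t : ℝ, 0 ≤ t → HasDerivWithinAt w (b t (w t) - d t (v t)) (Set.Ici 0) t)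
    (hw0 : ‖w t‖ ≤ C0 * ε ^ (n + 1)) (p : ℕ) :
    p ≤ min n q + 1 →
    ‖iteratedDerivWithin p w (Set.Ici 0) t‖ ≤ mmCst K M C0 p * ε ^ (n + 1 - p) := by
  induction p using Nat.strong_induction_on with
  | _ p ih =>
  intro hp
  cases p with
  | zero => simpa [mmCst] using hw0
  | succ p =>
    have hpn : p ≤ n := by omega
    have hpq : p ≤ q := by omega
    have hpq' : (p : WithTop ℕ∞) ≤ q := by exact_mod_cast hpq
    have hbp := hb.of_le hpq'
    have hdp := hd.of_le hpq'
    have hwp := mm_w_contDiff hb hd hv hw p (by omega)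
    have hCp := mmCst_nonneg hK hM hC p
    rw [iteratedDerivWithin_succ', iteratedDerivWithin_congr (s := Set.Ici 0)
      (g := (fun t => b t (w t)) - fun t => d t (v t))
      (fun x hx => (hw x hx).derivWithin (uniqueDiffOn_Ici 0 x hx)) ht,
      iteratedDerivWithin_sub (s := Set.Ici 0) ht (uniqueDiffOn_Ici 0)
        (mm_contDiff_apply hbp hwp t ht) (mm_contDiff_apply hdp (hv p) t ht)]
    have h1 := mm_leibniz (G := K * mmCst K M C0 p * ε ^ (n - p)) ht hbp hwp (by
      intro i hi
      calc _ ≤ (K / ε ^ i) * (mmCst K M C0 p * ε ^ (n + 1 - (p - i))) := by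
            gcongr
            · exact hbb i (by omega)
            · refine (ih (p - i) (by omega) (by omega)).trans ?_
              gcongr
              exact mmCst_mono hK hM hC (by omega)
        _ = K * mmCst K M C0 p * ε ^ (n + 1 - p) := by
            rw [show n + 1 - (p - i) = i + (n + 1 - p) by omega, pow_add]
            field_simp
        _ ≤ _ := by
            gcongr ?_ * ?_
            exact pow_le_pow_of_le_one hε.le hε1 (by omega))
    have h2 := mm_leibniz (G := K * M * ε ^ (n - p)) ht hdp (hv p) (by
      intro i hi
      calc _ ≤ (K * ε ^ n / ε ^ i) * M := by
            gcongr
            · exact hdb i (by omega)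
            · exact hvb (p - i) (by omega)
        _ = K * M * ε ^ (n - i) := by
            rw [show ε ^ n = ε ^ i * ε ^ (n - i) by rw [← pow_add]; congr 1; omega]
            field_simp
        _ ≤ _ := by
            gcongr ?_ * ?_
            exact pow_le_pow_of_le_one hε.le hε1 (by omega))
    refine (norm_sub_le _ _).trans ((add_le_add h1 h2).trans ?_)
    rw [show n + 1 - (p + 1) = n - p by omega]
    simp only [mmCst]
    have : 0 ≤ mmCst K M C0 p * ε ^ (n - p) := by positivity
    linarith

lemma mm_w_bound [CompleteSpace X] {b d : ℝ → (X →L[ℂ] X)} {A : X →L[ℂ] X} {v w : ℝ → X}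
    {K T M R : ℝ} (hK : 0 < K) (hM : 0 ≤ M) (hR : 0 ≤ R)
    (hd : ContinuousOn d (Set.Ici 0))
    (hbb : ∀ t : ℝ, 0 ≤ t → ‖b t‖ ≤ K) (hA : ‖A‖ ≤ K)
    (hD : ∀ t : ℝ, 0 ≤ t → ‖∫ σ in (0:ℝ)..t, d σ‖ ≤ K * R)
    (hv : ∀ t : ℝ, 0 ≤ t → HasDerivWithinAt v (A (v t)) (Set.Ici 0) t)
    (hvM : ∀ t ∈ Set.Icc (0:ℝ) T, ‖v t‖ ≤ M)
    (hw : ∀ t : ℝ, 0 ≤ t → HasDerivWithinAt w (b t (w t) - d t (v t)) (Set.Ici 0) t)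
    (hw0 : w 0 = 0) :
    ∀ t ∈ Set.Icc (0:ℝ) T, ‖w t‖ ≤ (2 * K * M * Real.exp (K * T) + K * M) * R := by
  have hg : Continuous fun σ : ℝ => d (max σ 0) :=
    hd.comp_continuous (by fun_prop) fun x => Set.mem_Ici.2 (le_max_right _ _)
  set D : ℝ → (X →L[ℂ] X) := fun t => ∫ σ in (0:ℝ)..t, d (max σ 0) with hDdef
  have hDb : ∀ t : ℝ, 0 ≤ t → ‖D t‖ ≤ K * R := fun t ht => by
    have : D t = ∫ σ in (0:ℝ)..t, d σ := by
      refine intervalIntegral.integral_congr fun σ hσ => ?_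
      rw [Set.uIcc_of_le ht] at hσ
      simp [max_eq_left hσ.1]
    rw [this]; exact hD t ht
  have hDd : ∀ t : ℝ, 0 ≤ t → HasDerivWithinAt D (d t) (Set.Ici 0) t := fun t ht => by
    have := (hg.integral_hasStrictDerivAt 0 t).hasDerivAt.hasDerivWithinAt (s := Set.Ici 0)
    simpa [max_eq_left ht] using this
  have hz : ∀ t : ℝ, 0 ≤ t → HasDerivWithinAt (fun t => w t + D t (v t))
      ((b t (w t) - d t (v t)) + (D t (A (v t)) + d t (v t))) (Set.Ici 0) t := fun t ht =>
    (hw t ht).add ((mmBil X).hasDerivWithinAt_of_bilinear (hDd t ht) (hv t ht))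
  intro t ht
  have key := norm_le_gronwallBound_of_norm_deriv_right_le (f := fun t => w t + D t (v t))
    (f' := fun t => ((b t (w t) - d t (v t)) + (D t (A (v t)) + d t (v t))))
    (δ := 0) (K := K) (ε := K * (2 * K * M * R)) (a := 0) (b := T)
    (fun x hx => ((hz x hx.1).continuousWithinAt).mono Set.Icc_subset_Ici_self)
    (fun x hx => (hz x hx.1).mono (Set.Ici_subset_Ici.2 hx.1))
    (by simp [hw0, hDdef])
    (fun x hx => by
      have hx0 := hx.1
      have hvx := hvM x ⟨hx.1, hx.2.le⟩
      have e : (b x (w x) - d x (v x)) + (D x (A (v x)) + d x (v x))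
        = b x (w x + D x (v x)) + (D x (A (v x)) - b x (D x (v x))) := by
          rw [map_add]; abel
      rw [e]
      have e1 : ‖b x (w x + D x (v x))‖ ≤ K * ‖w x + D x (v x)‖ :=
        ((b x).le_opNorm _).trans (by gcongr; exact hbb x hx0)
      have e2 : ‖D x (A (v x))‖ ≤ (K * R) * (K * M) :=
        ((D x).le_opNorm _).trans (by
          gcongr
          · exact hDb x hx0
          · exact (A.le_opNorm _).trans (by gcongr))
      have e3 : ‖b x (D x (v x))‖ ≤ K * ((K * R) * M) :=
        ((b x).le_opNorm _).trans (by
          gcongr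
          · exact hbb x hx0
          · exact ((D x).le_opNorm _).trans (by gcongr; exact hDb x hx0))
      refine (norm_add_le _ _).trans ?_
      have := norm_sub_le (D x (A (v x))) (b x (D x (v x)))
      nlinarith) t ht
  rw [gronwallBound_of_K_ne_0 hK.ne'] at key
  have hexp : Real.exp (K * (t - 0)) - 1 ≤ Real.exp (K * T) := by
    have : Real.exp (K * (t - 0)) ≤ Real.exp (K * T) := by
      gcongr; linarith [ht.2]
    linarith
  have hDv : ‖D t (v t)‖ ≤ (K * R) * M :=
    ((D t).le_opNorm _).trans (by gcongr; exacts [hDb t ht.1, hvM t ht])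
  have e : w t = (w t + D t (v t)) - D t (v t) := by abel
  rw [e]
  refine (norm_sub_le _ _).trans ?_
  have k2 : ‖w t + D t (v t)‖ ≤ 2 * K * M * R * Real.exp (K * T) := by
    refine key.trans ?_
    beta_reduce
    rw [zero_mul, zero_add, mul_div_cancel_left₀ _ hK.ne']
    gcongr
  linarith

end Helpers

/-- uniform bounds on the derivatives of the micro-macro variables,
Corollary 2.10 of the paper. If `a` is `C^q` with derivatives bounded by `K`,
`|A| ≤ K`, the defect `δ` is `C^q` with derivatives of size `K ε^n` and primitive
`|∫₀^t δ_{σ/ε}| ≤ K ε^{n+1}`, if `v` solves the macro equation with `|v(0)| ≤ K`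
and `w` the micro equation with `w(0) = 0`, then `v` and `w` are `C^{min(n,q)+1}`
on `[0,T]` and, for a constant `C` depending only on `K, T, n, q` (not on `ε`),
`|∂_t^p v| ≤ C` and `|∂_t^p w| ≤ C ε^{n+1−p}` for all `0 ≤ p ≤ min(n,q)+1`. -/
theorem microMacro_deriv_bounds
    {X : Type*} [NormedAddCommGroup X] [NormedSpace ℂ X] [CompleteSpace X]
    (n q : ℕ) (T K : ℝ) (hT : 0 < T) (hK : 0 < K) :
    ∃ C : ℝ, 0 < C ∧
      ∀ ε : ℝ, 0 < ε → ε ≤ 1 →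
      ∀ (a δ : ℝ → (X →L[ℂ] X)) (A : X →L[ℂ] X) (v w : ℝ → X),
        ContDiffOn ℝ (q : ℕ∞) a (Set.Ici 0) →
        (∀ p ≤ q, ∀ τ : ℝ, 0 ≤ τ → ‖iteratedDerivWithin p a (Set.Ici 0) τ‖ ≤ K) →
        ‖A‖ ≤ K →
        ContDiffOn ℝ (q : ℕ∞) δ (Set.Ici 0) →
        (∀ p ≤ q, ∀ τ : ℝ, 0 ≤ τ →
          ‖iteratedDerivWithin p δ (Set.Ici 0) τ‖ ≤ K * ε ^ n) →
        (∀ t : ℝ, 0 ≤ t → ‖∫ σ in (0:ℝ)..t, δ (σ / ε)‖ ≤ K * ε ^ (n + 1)) →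
        (∀ t : ℝ, 0 ≤ t → HasDerivWithinAt v (A (v t)) (Set.Ici 0) t) →
        ‖v 0‖ ≤ K →
        (∀ t : ℝ, 0 ≤ t →
          HasDerivWithinAt w ((a (t / ε)) (w t) - (δ (t / ε)) (v t)) (Set.Ici 0) t) →
        w 0 = 0 →
        ContDiffOn ℝ ((min n q + 1 : ℕ) : ℕ∞) v (Set.Icc 0 T) ∧
        ContDiffOn ℝ ((min n q + 1 : ℕ) : ℕ∞) w (Set.Icc 0 T) ∧
        ∀ p ≤ min n q + 1, ∀ t ∈ Set.Icc (0:ℝ) T,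
          ‖iteratedDerivWithin p v (Set.Icc 0 T) t‖ ≤ C ∧
          ‖iteratedDerivWithin p w (Set.Icc 0 T) t‖ ≤ C * ε ^ (n + 1 - p) := by
  set M0 : ℝ := K * Real.exp (K * T) with hM0
  have hM0p : 0 < M0 := by positivity
  set M : ℝ := (1 + K) ^ (n + 1) * M0 with hM
  have hMp : 0 < M := by positivity
  set C0 : ℝ := 2 * K * M0 * Real.exp (K * T) + K * M0 with hC0
  have hC0p : 0 < C0 := by positivity
  have hCn := mmCst_nonneg hK.le hMp.le hC0p.le (n + 1)
  refine ⟨M + mmCst K M C0 (n + 1), by positivity, ?_⟩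
  intro ε hε hε1 a δ A v w ha hab hA hδ hδb hδi hv hv0 hw hw0
  have hvC := mm_v_contDiff hv
  obtain ⟨hb, hbb⟩ := mm_scale hε ha hab
  obtain ⟨hd, hdb⟩ := mm_scale hε hδ hδb
  have hwC : ∀ k ≤ q + 1, ContDiffOn ℝ k w (Set.Ici 0) := mm_w_contDiff hb hd hvC hw
  have hsub : Set.Icc (0:ℝ) T ⊆ Set.Ici 0 := Set.Icc_subset_Ici_self
  have hvM := mm_v_bound (T := T) hA hv hK hv0
  have hwM := mm_w_bound (T := T) (R := ε ^ (n + 1)) hK hM0p.le (by positivity) hd.continuousOn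
    (fun t ht => by simpa using hbb 0 (Nat.zero_le _) t ht) hA hδi hv hvM hw hw0
  refine ⟨(hvC _).mono hsub, (hwC _ (by omega)).mono hsub, fun p hp t ht => ?_⟩
  have hvb : ∀ p ≤ n + 1, ‖iteratedDerivWithin p v (Set.Ici 0) t‖ ≤ M := fun p hp => by
    rw [mm_v_iter hv p t ht.1]
    refine ((A ^ p).le_opNorm _).trans ?_
    have hAp : ‖A ^ p‖ ≤ (1 + K) ^ (n + 1) := by
      have h1 : ‖A ^ p‖ ≤ (1 + K) ^ p := by
        rcases Nat.eq_zero_or_pos p with rfl | hp0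
        · rw [pow_zero, pow_zero]
          exact ContinuousLinearMap.norm_id_le
        · refine (norm_pow_le' A hp0).trans ?_
          gcongr
          linarith
      exact h1.trans (pow_le_pow_right₀ (by linarith) hp)
    exact mul_le_mul hAp (hvM t ht) (norm_nonneg _) (by positivity)
  have eqv : iteratedDerivWithin p v (Set.Icc 0 T) t = iteratedDerivWithin p v (Set.Ici 0) t := by
    rw [iteratedDerivWithin, iteratedDerivWithin,
      iteratedFDerivWithin_subset hsub (uniqueDiffOn_Icc hT) (uniqueDiffOn_Ici 0) (hvC p) ht]
  have eqw : iteratedDerivWithin p w (Set.Icc 0 T) t = iteratedDerivWithin p w (Set.Ici 0) t := by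
    rw [iteratedDerivWithin, iteratedDerivWithin,
      iteratedFDerivWithin_subset hsub (uniqueDiffOn_Icc hT) (uniqueDiffOn_Ici 0)
        (hwC p (by omega)) ht]
  rw [eqv, eqw]
  constructor
  · linarith [hvb p (by omega)]
  · refine (mm_w_iter hε hK.le hMp.le hC0p.le ht.1 hb hd (fun p hp => hbb p hp t ht.1)
      (fun p hp => hdb p hp t ht.1) hvC (fun p hp => hvb p (by omega)) hε1 hw (hwM t ht) p hp).trans ?_
    gcongr
    have := mmCst_mono hK.le hMp.le hC0p.le (show p ≤ n + 1 by omega)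
    linarith
end
end
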